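/- arXiv:1012.1843 — 10 statements merged into one kernel-verified Lean document; each statement's English description precedes it below -/
import Mathlib

section
/- Suppose y : [0, t_e) → [x₀, ∞) is differentiable with y(0) = x₀ and y'(t) = a(t)·b(y(t)) for all t ∈ [0, t_e), where t_e < ∞, and suppose y(t) → ∞ as t → t_e⁻. Then B(∞) = A(t_e), and in particular B(∞) < A(∞); that is, if the solution of the initial-value problem explodes in finite time then ∫_{x₀}^∞ ds/b(s) < ∫_0^∞ a(s) ds and the explosion time equals A⁻¹(B(∞)). -/
open MeasureTheory Set Filter Topology
open scoped ENNReal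

/-- A continuous function on `[a, b)` tending to `+∞` at `b` takes every value above `f a`. -/
theorem Ici_subset_image_Ico_of_tendsto_atTop {f : ℝ → ℝ} {a b : ℝ} (hab : a < b)
    (hf : ContinuousOn f (Ico a b)) (hlim : Tendsto f (𝓝[<] b) atTop) :
    Ici (f a) ⊆ f '' Ico a b := by
  intro z hz
  obtain ⟨t, hzt, ht⟩ :=
    ((hlim.eventually_ge_atTop z).and (Ico_mem_nhdsLT hab)).exists
  obtain ⟨c, hc, rfl⟩ := intermediate_value_Icc ht.1
    (hf.mono (Icc_subset_Ico_right ht.2)) ⟨hz, hzt⟩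
  exact ⟨c, ⟨hc.1, hc.2.trans_lt ht.2⟩, rfl⟩

/-- Separation of variables for a nondecreasing solution of `y' = a t * b (y t)`. -/
theorem lintegral_one_div_image_eq_lintegral {a b y : ℝ → ℝ} {s : Set ℝ}
    (hs : MeasurableSet s) (hb : ∀ t ∈ s, 0 < b (y t)) (hmono : MonotoneOn y s)
    (hy : ∀ t ∈ s, HasDerivWithinAt y (a t * b (y t)) s t) :
    ∫⁻ x in y '' s, ENNReal.ofReal (1 / b x) = ∫⁻ t in s, ENNReal.ofReal (a t) := by
  rw [lintegral_image_eq_lintegral_deriv_mul_of_monotoneOn hs hy hmono]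
  refine setLIntegral_congr_fun hs fun t ht => ?_
  have hbt := hb t ht
  rw [← ENNReal.ofReal_mul' (by positivity), mul_assoc, mul_one_div_cancel hbt.ne', mul_one]

/-- If the solution of `y' = a t * b (y t)`, `y 0 = x₀`, explodes at a finite time
`t_e`, then `B ∞ = A t_e`, and in particular `B ∞ < A ∞`:
`∫_{x₀}^∞ ds / b s = ∫_0^{t_e} a s ds` and `∫_{x₀}^∞ ds / b s < ∫_0^∞ a s ds`. -/
theorem osgood_explosion_necessary
    (x₀ : ℝ) (hx₀ : 0 < x₀) (a b : ℝ → ℝ)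
    (ha_cont : ContinuousOn a (Ici 0)) (ha_pos : ∀ t ∈ Ici (0 : ℝ), 0 < a t)
    (hb_cont : ContinuousOn b (Ici 0)) (hb_pos : ∀ t ∈ Ici (0 : ℝ), 0 < b t)
    (t_e : ℝ) (ht_e : 0 < t_e) (y : ℝ → ℝ)
    (hy_ge : ∀ t ∈ Ico 0 t_e, x₀ ≤ y t)
    (hy0 : y 0 = x₀)
    (hy_deriv : ∀ t ∈ Ico 0 t_e, HasDerivAt y (a t * b (y t)) t)
    (hy_blowup : Tendsto y (𝓝[<] t_e) atTop) :
    (∫⁻ s in Ioi x₀, ENNReal.ofReal (1 / b s))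
        = ENNReal.ofReal (∫ s in (0 : ℝ)..t_e, a s) ∧
    (∫⁻ s in Ioi x₀, ENNReal.ofReal (1 / b s))
        < ∫⁻ s in Ioi (0 : ℝ), ENNReal.ofReal (a s) := by
  have hb_y : ∀ t ∈ Ico 0 t_e, 0 < b (y t) := fun t ht =>
    hb_pos _ (hx₀.le.trans (hy_ge t ht))
  have hy_cont : ContinuousOn y (Ico 0 t_e) := fun t ht =>
    (hy_deriv t ht).continuousAt.continuousWithinAt
  have hy_mono : MonotoneOn y (Ico 0 t_e) := by
    refine monotoneOn_of_hasDerivWithinAt_nonneg (convex_Ico 0 t_e) hy_cont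
      (fun t ht => (hy_deriv t (interior_subset ht)).hasDerivWithinAt) fun t ht => ?_
    have ht := interior_subset ht
    exact (mul_pos (ha_pos t ht.1) (hb_y t ht)).le
  have himage : y '' Ico 0 t_e = Ici x₀ := by
    refine Subset.antisymm (image_subset_iff.2 hy_ge) ?_
    rw [← hy0]
    exact Ici_subset_image_Ico_of_tendsto_atTop ht_e hy_cont hy_blowup
  have hB : (∫⁻ s in Ioi x₀, ENNReal.ofReal (1 / b s))
      = ∫⁻ t in Ioc 0 t_e, ENNReal.ofReal (a t) := by
    rw [setLIntegral_congr Ioi_ae_eq_Ici, ← himage,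
      lintegral_one_div_image_eq_lintegral measurableSet_Ico hb_y hy_mono
        fun t ht => (hy_deriv t ht).hasDerivWithinAt]
    exact setLIntegral_congr Ico_ae_eq_Ioc
  have ha_int : IntegrableOn a (Ioc 0 t_e) :=
    ((ha_cont.mono Icc_subset_Ici_self).integrableOn_Icc).mono_set Ioc_subset_Icc_self
  have hA : ENNReal.ofReal (∫ s in (0 : ℝ)..t_e, a s)
      = ∫⁻ t in Ioc 0 t_e, ENNReal.ofReal (a t) := by
    rw [intervalIntegral.integral_of_le ht_e.le]
    refine ofReal_integral_eq_lintegral_ofReal ha_int ?_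
    filter_upwards [ae_restrict_mem measurableSet_Ioc] with t ht
    exact (ha_pos t ht.1.le).le
  refine ⟨hB.trans hA.symm, ?_⟩
  have htail : 0 < ∫⁻ t in Ioi t_e, ENNReal.ofReal (a t) := by
    have hmeas : AEMeasurable (fun t => ENNReal.ofReal (a t)) (volume.restrict (Ioi t_e)) :=
      ((ha_cont.mono fun t ht => ht_e.le.trans (le_of_lt ht)).aemeasurable
        measurableSet_Ioi).ennreal_ofReal
    rw [pos_iff_ne_zero, Ne, lintegral_eq_zero_iff' hmeas]
    intro h
    have hfalse : ∀ᵐ t ∂volume.restrict (Ioi t_e), False := by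
      filter_upwards [h, ae_restrict_mem measurableSet_Ioi] with t h0 ht
      exact (ENNReal.ofReal_pos.2 (ha_pos t (ht_e.le.trans (le_of_lt ht)))).ne' h0
    rw [eventually_false_iff_eq_bot, ae_eq_bot, Measure.restrict_eq_zero] at hfalse
    simp at hfalse
  rw [hB, ← Ioc_union_Ioi_eq_Ioi ht_e.le,
    lintegral_union measurableSet_Ioi (Ioc_disjoint_Ioi le_rfl)]
  exact ENNReal.lt_add_right (hA ▸ ENNReal.ofReal_ne_top) htail.ne'
end

section
/- Assume b is non-decreasing and let 0 < x₀ ≤ x₁ be real numbers. If T > 0 and v : [0, T] → ℝ is a continuous function satisfying v(t) ≥ x₁ + ∫_0^t a(s)·b(v(s)) ds for all t ∈ [0, T], then ∫_0^T a(s) ds ≤ ∫_{x₀}^∞ ds/b(s). (Equivalently, any real-valued super-solution can exist only up to time A⁻¹(B(∞)): its explosion time is at most A⁻¹(B(∞)).) -/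
open MeasureTheory Set Filter Topology
open scoped ENNReal

open intervalIntegral in
theorem hasDerivAt_integral_of_continuousOn_Icc {f : ℝ → ℝ} {p q x : ℝ}
    (hf : ContinuousOn f (Icc p q)) (hx : x ∈ Ioo p q) :
    HasDerivAt (fun t => ∫ s in p..t, f s) (f x) x := by
  have hsub : ContinuousOn f (Ioo p q) := hf.mono Ioo_subset_Icc_self
  refine integral_hasDerivAt_right ?_ (hsub.stronglyMeasurableAtFilter isOpen_Ioo x hx)
    (hsub.continuousAt (isOpen_Ioo.mem_nhds hx))
  refine ContinuousOn.intervalIntegrable ?_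
  rw [uIcc_of_le hx.1.le]
  exact hf.mono (Icc_subset_Icc_right hx.2.le)

theorem continuousOn_integral_of_continuousOn_Icc {f : ℝ → ℝ} {p q : ℝ} (hpq : p ≤ q)
    (hf : ContinuousOn f (Icc p q)) :
    ContinuousOn (fun t => ∫ s in p..t, f s) (Icc p q) := by
  have h := intervalIntegral.continuousOn_primitive_interval' (μ := volume) (f := f)
    (hf.intervalIntegrable_of_Icc hpq) left_mem_uIcc
  rwa [uIcc_of_le hpq] at h

/-- A super-solution starting from a positive value stays positive. -/
theorem supersolution_pos {x₁ T : ℝ} (hx₁ : 0 < x₁) {a b v : ℝ → ℝ}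
    (ha_pos : ∀ t ∈ Ici (0 : ℝ), 0 < a t) (hb_pos : ∀ t ∈ Ici (0 : ℝ), 0 < b t)
    (hv_cont : ContinuousOn v (Icc 0 T))
    (hv : ∀ t ∈ Icc (0 : ℝ) T, x₁ + (∫ s in (0 : ℝ)..t, a s * b (v s)) ≤ v t) :
    ∀ t ∈ Icc (0 : ℝ) T, 0 < v t := by
  by_contra! hne
  obtain ⟨t₀, ht₀, hvt₀⟩ := hne
  have hclosed : IsClosed (Icc 0 T ∩ v ⁻¹' Iic 0) :=
    hv_cont.preimage_isClosed_of_isClosed isClosed_Icc isClosed_Iic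
  have hcomp : IsCompact (Icc 0 T ∩ v ⁻¹' Iic 0) :=
    isCompact_Icc.of_isClosed_subset hclosed inter_subset_left
  obtain ⟨m, ⟨hm, hvm⟩, hmin⟩ := hcomp.exists_isLeast ⟨t₀, ht₀, hvt₀⟩
  have hint : 0 ≤ ∫ s in (0 : ℝ)..m, a s * b (v s) := by
    rw [intervalIntegral.integral_of_le hm.1, integral_Ioc_eq_integral_Ioo]
    refine setIntegral_nonneg measurableSet_Ioo fun s hs => ?_
    have hvs : 0 < v s := by
      by_contra! h
      exact absurd (hmin ⟨⟨hs.1.le, hs.2.le.trans hm.2⟩, h⟩) hs.2.not_ge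
    exact (mul_pos (ha_pos s hs.1.le) (hb_pos _ hvs.le)).le
  have := hv m hm
  have hvm' : v m ≤ 0 := hvm
  linarith

/-- If `b` is non-decreasing, `0 < x₀ ≤ x₁`, and `v : [0, T] → ℝ` is a continuous
super-solution, `v t ≥ x₁ + ∫_0^t a s * b (v s) ds` on `[0, T]`, then
`∫_0^T a s ds ≤ ∫_{x₀}^∞ ds / b s`; i.e. a real-valued super-solution can only
exist up to time `A⁻¹(B ∞)`. -/
theorem supersolution_time_bound
    (x₀ x₁ : ℝ) (hx₀ : 0 < x₀) (hx₀₁ : x₀ ≤ x₁) (a b : ℝ → ℝ)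
    (ha_cont : ContinuousOn a (Ici 0)) (ha_pos : ∀ t ∈ Ici (0 : ℝ), 0 < a t)
    (hb_cont : ContinuousOn b (Ici 0)) (hb_pos : ∀ t ∈ Ici (0 : ℝ), 0 < b t)
    (hb_mono : MonotoneOn b (Ici 0))
    (T : ℝ) (hT : 0 < T) (v : ℝ → ℝ)
    (hv_cont : ContinuousOn v (Icc 0 T))
    (hv : ∀ t ∈ Icc (0 : ℝ) T, x₁ + (∫ s in (0 : ℝ)..t, a s * b (v s)) ≤ v t) :
    ENNReal.ofReal (∫ s in (0 : ℝ)..T, a s)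
      ≤ ∫⁻ s in Ioi x₀, ENNReal.ofReal (1 / b s) := by
  have hx₁ : 0 < x₁ := hx₀.trans_le hx₀₁
  have hv_pos := supersolution_pos hx₁ ha_pos hb_pos hv_cont hv
  have ha_T : ContinuousOn a (Icc 0 T) := ha_cont.mono Icc_subset_Ici_self
  have hf : ContinuousOn (fun s => a s * b (v s)) (Icc 0 T) :=
    ha_T.mul (hb_cont.comp hv_cont fun t ht => (hv_pos t ht).le)
  have hinv : ContinuousOn (fun s => 1 / b s) (Ici 0) :=
    continuousOn_const.div hb_cont fun t ht => (hb_pos t ht).ne'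
  set u : ℝ → ℝ := fun t => x₁ + ∫ s in (0 : ℝ)..t, a s * b (v s) with hu
  have hu_ge : ∀ t ∈ Icc 0 T, x₁ ≤ u t := fun t ht =>
    le_add_of_nonneg_right <| intervalIntegral.integral_nonneg ht.1 fun s hs =>
      (mul_pos (ha_pos s hs.1) (hb_pos _ (hv_pos s ⟨hs.1, hs.2.trans ht.2⟩).le)).le
  have hu_cont : ContinuousOn u (Icc 0 T) :=
    continuousOn_const.add (continuousOn_integral_of_continuousOn_Icc hT.le hf)
  have hu_deriv : ∀ t ∈ Ioo 0 T, HasDerivAt u (a t * b (v t)) t := fun t ht =>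
    (hasDerivAt_integral_of_continuousOn_Icc hf ht).const_add x₁
  have hG_deriv : ∀ y, 0 < y →
      HasDerivAt (fun y => ∫ s in (0 : ℝ)..y, 1 / b s) (1 / b y) y := fun y hy =>
    hasDerivAt_integral_of_continuousOn_Icc (q := y + 1) (hinv.mono Icc_subset_Ici_self)
      ⟨hy, lt_add_one y⟩
  have hmono : MonotoneOn
      (fun t => (∫ s in (0 : ℝ)..u t, 1 / b s) - ∫ s in (0 : ℝ)..t, a s) (Icc 0 T) := by
    have hderiv : ∀ t ∈ Ioo 0 T, HasDerivAt
        (fun t => (∫ s in (0 : ℝ)..u t, 1 / b s) - ∫ s in (0 : ℝ)..t, a s)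
        (1 / b (u t) * (a t * b (v t)) - a t) t := fun t ht =>
      ((hG_deriv (u t) (hx₁.trans_le (hu_ge t (Ioo_subset_Icc_self ht)))).comp t
        (hu_deriv t ht)).sub (hasDerivAt_integral_of_continuousOn_Icc ha_T ht)
    refine monotoneOn_of_deriv_nonneg (convex_Icc 0 T) ?_ ?_ ?_
    · refine ContinuousOn.sub (fun t ht => ?_) (continuousOn_integral_of_continuousOn_Icc hT.le ha_T)
      exact (hG_deriv (u t) (hx₁.trans_le (hu_ge t ht))).continuousAt.comp_continuousWithinAt
        (hu_cont t ht)
    · rw [interior_Icc]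
      exact fun t ht => (hderiv t ht).differentiableAt.differentiableWithinAt
    · rw [interior_Icc]
      intro t ht
      have ht' := Ioo_subset_Icc_self ht
      have hu0 : 0 ≤ u t := hx₁.le.trans (hu_ge t ht')
      have hbu : 0 < b (u t) := hb_pos _ hu0
      have hb_le : b (u t) ≤ b (v t) := hb_mono hu0 (hv_pos t ht').le (hv t ht')
      rw [(hderiv t ht).deriv, sub_nonneg, one_div, inv_mul_eq_div, le_div_iff₀ hbu]
      exact mul_le_mul_of_nonneg_left hb_le (ha_pos t ht.1.le).le
  have huT : x₁ ≤ u T := hu_ge T (right_mem_Icc.2 hT.le)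
  have hint : ∀ y, 0 ≤ y → IntervalIntegrable (fun s => 1 / b s) volume 0 y := fun y hy =>
    (hinv.mono Icc_subset_Ici_self).intervalIntegrable_of_Icc hy
  have hA : ∫ s in (0 : ℝ)..T, a s ≤ ∫ s in x₁..u T, 1 / b s := by
    have h := hmono (left_mem_Icc.2 hT.le) (right_mem_Icc.2 hT.le) hT.le
    have hu0 : u 0 = x₁ := by simp [hu]
    simp only [hu0, intervalIntegral.integral_same, sub_zero] at h
    rw [← intervalIntegral.integral_interval_sub_left (hint _ (hx₁.le.trans huT)) (hint _ hx₁.le)]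
    linarith
  calc ENNReal.ofReal (∫ s in (0 : ℝ)..T, a s)
      ≤ ENNReal.ofReal (∫ s in x₁..u T, 1 / b s) := ENNReal.ofReal_le_ofReal hA
    _ = ∫⁻ s in Ioc x₁ (u T), ENNReal.ofReal (1 / b s) := by
        rw [intervalIntegral.integral_of_le huT]
        refine ofReal_integral_eq_lintegral_ofReal ?_ ?_
        · exact (hinv.mono fun s hs => hx₁.le.trans hs.1).integrableOn_Icc.mono_set
            Ioc_subset_Icc_self
        · refine (ae_restrict_iff' measurableSet_Ioc).2 (ae_of_all _ fun s hs => ?_)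
          exact (one_div_pos.2 (hb_pos s (hx₁.trans hs.1).le)).le
    _ ≤ ∫⁻ s in Ioi x₀, ENNReal.ofReal (1 / b s) :=
        lintegral_mono_set fun s hs => hx₀₁.trans_lt hs.1
end

section
/- Assume b is non-decreasing and B(∞) < A(∞). If T > 0 and Y : [0, T] → ℝ is a continuous function satisfying Y(t) = x₀ + ∫_0^t a(s)·b(Y(s) + g(s)) ds for all t ∈ [0, T], then A(T) ≤ B(∞). In particular, no such solution exists on all of [0, ∞); the solution of the integral equation with noise explodes in finite time, and its explosion time is at most A⁻¹(B(∞)). -/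
open MeasureTheory Set Filter Topology
open scoped ENNReal

/-- A set integral over `Ioi c` of a nonnegative function is bounded by any bound for the
integrals over all `Ioc c (c + n)`. -/
lemma setLIntegral_Ioi_le_of_forall_Ioc {f : ℝ → ℝ≥0∞} {c : ℝ} {M : ℝ≥0∞}
    (h : ∀ T, c < T → ∫⁻ s in Ioc c T, f s ≤ M) : ∫⁻ s in Ioi c, f s ≤ M := by
  have hU : Ioi c = ⋃ n : ℕ, Ioc c (c + (n + 1)) := by
    ext x
    simp only [mem_Ioi, mem_iUnion, mem_Ioc]
    refine ⟨fun hx => ?_, fun ⟨_, hn, _⟩ => hn⟩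
    obtain ⟨n, hn⟩ := exists_nat_ge (x - c)
    exact ⟨n, hx, by linarith⟩
  have hmono : Monotone fun n : ℕ => Ioc c (c + ((n : ℝ) + 1)) := fun m n hmn =>
    Ioc_subset_Ioc_right (by gcongr)
  rw [hU, setLIntegral_iUnion_of_directed _ hmono.directed_le]
  exact iSup_le fun n => h _ (by linarith [n.cast_nonneg (α := ℝ)])

/-- The interval integral of a function continuous and nonnegative on `[c, d]`, as a
Lebesgue integral. -/
lemma ofReal_intervalIntegral_eq_setLIntegral {f : ℝ → ℝ} {c d : ℝ} (hcd : c ≤ d)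
    (hf : ContinuousOn f (Icc c d)) (hf0 : ∀ s ∈ Icc c d, 0 ≤ f s) :
    ENNReal.ofReal (∫ s in c..d, f s) = ∫⁻ s in Ioc c d, ENNReal.ofReal (f s) := by
  rw [intervalIntegral.integral_of_le hcd]
  refine ofReal_integral_eq_lintegral_ofReal
    (hf.integrableOn_Icc.mono_set Ioc_subset_Icc_self) ?_
  exact (ae_restrict_iff' measurableSet_Ioc).2
    (.of_forall fun s hs => hf0 s (Ioc_subset_Icc_self hs))

/-- A continuous solution of `Y t = x₀ + ∫_0^t φ s (Y s) ds` stays above its positive initial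
value when `φ s y` is nonnegative for `y > 0`. -/
lemma le_of_eq_add_integral {x₀ T : ℝ} (hx₀ : 0 < x₀) {φ : ℝ → ℝ → ℝ} {Y : ℝ → ℝ}
    (hφ : ∀ s ∈ Icc 0 T, ∀ y, 0 < y → 0 ≤ φ s y) (hY : ContinuousOn Y (Icc 0 T))
    (hYeq : ∀ t ∈ Icc (0 : ℝ) T, Y t = x₀ + ∫ s in (0 : ℝ)..t, φ s (Y s)) :
    ∀ t ∈ Icc 0 T, x₀ ≤ Y t := by
  have step : ∀ t ∈ Icc 0 T, (∀ s ∈ Ioo 0 t, 0 < Y s) → x₀ ≤ Y t := by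
    intro t ht hpos
    rw [hYeq t ht, intervalIntegral.integral_of_le ht.1, integral_Ioc_eq_integral_Ioo]
    exact le_add_of_nonneg_right (setIntegral_nonneg measurableSet_Ioo fun s hs =>
      hφ s ⟨hs.1.le, hs.2.le.trans ht.2⟩ _ (hpos s hs))
  have hpos : ∀ t ∈ Icc 0 T, 0 < Y t := by
    by_contra! hne
    have hK : IsCompact (Icc 0 T ∩ Y ⁻¹' Iic 0) :=
      isCompact_Icc.of_isClosed_subset (hY.preimage_isClosed_of_isClosed isClosed_Icc isClosed_Iic)
        inter_subset_left
    obtain ⟨τ, ⟨hτ, hYτ⟩, hmin⟩ := hK.exists_isLeast hne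
    have := step τ hτ fun s hs => by
      by_contra! hs0
      exact hs.2.not_ge (hmin ⟨⟨hs.1.le, hs.2.le.trans hτ.2⟩, hs0⟩)
    exact (hx₀.trans_le this).not_ge hYτ
  exact fun t ht => step t ht fun s hs => hpos s ⟨hs.1.le, hs.2.le.trans ht.2⟩

/-- If `b` is non-decreasing and `B ∞ < A ∞`, then any continuous solution of the
integral equation with noise `Y t = x₀ + ∫_0^t a s * b (Y s + g s) ds` on `[0, T]`
satisfies `A T ≤ B ∞`; in particular no such solution exists on all of `[0, ∞)`:
the solution explodes in finite time, at a time at most `A⁻¹(B ∞)`. -/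
theorem noisy_explosion
    (x₀ : ℝ) (hx₀ : 0 < x₀) (a b g : ℝ → ℝ)
    (ha_cont : ContinuousOn a (Ici 0)) (ha_pos : ∀ t ∈ Ici (0 : ℝ), 0 < a t)
    (hb_cont : ContinuousOn b (Ici 0)) (hb_pos : ∀ t ∈ Ici (0 : ℝ), 0 < b t)
    (hb_mono : MonotoneOn b (Ici 0))
    (hg_cont : ContinuousOn g (Ici 0)) (hg_nonneg : ∀ t ∈ Ici (0 : ℝ), 0 ≤ g t)
    (hBA : (∫⁻ s in Ioi x₀, ENNReal.ofReal (1 / b s))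
        < ∫⁻ s in Ioi (0 : ℝ), ENNReal.ofReal (a s)) :
    (∀ T : ℝ, 0 < T → ∀ Y : ℝ → ℝ, ContinuousOn Y (Icc 0 T) →
      (∀ t ∈ Icc (0 : ℝ) T, Y t = x₀ + ∫ s in (0 : ℝ)..t, a s * b (Y s + g s)) →
      ENNReal.ofReal (∫ s in (0 : ℝ)..T, a s)
        ≤ ∫⁻ s in Ioi x₀, ENNReal.ofReal (1 / b s)) ∧
    ¬ ∃ Y : ℝ → ℝ, ContinuousOn Y (Ici 0) ∧
        ∀ t ∈ Ici (0 : ℝ), Y t = x₀ + ∫ s in (0 : ℝ)..t, a s * b (Y s + g s) := by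
  have bound : ∀ T : ℝ, 0 < T → ∀ Y : ℝ → ℝ, ContinuousOn Y (Icc 0 T) →
      (∀ t ∈ Icc (0 : ℝ) T, Y t = x₀ + ∫ s in (0 : ℝ)..t, a s * b (Y s + g s)) →
      ENNReal.ofReal (∫ s in (0 : ℝ)..T, a s)
        ≤ ∫⁻ s in Ioi x₀, ENNReal.ofReal (1 / b s) := by
    intro T hT Y hY hYeq
    have hsub : Icc 0 T ⊆ Ici (0 : ℝ) := Icc_subset_Ici_self
    have hYge : ∀ t ∈ Icc 0 T, x₀ ≤ Y t :=
      le_of_eq_add_integral (φ := fun s y => a s * b (y + g s)) hx₀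
        (fun s hs y hy => (mul_pos (ha_pos s hs.1)
          (hb_pos _ (add_nonneg hy.le (hg_nonneg s hs.1)))).le) hY hYeq
    have hY0 : ∀ t ∈ Icc 0 T, 0 ≤ Y t := fun t ht => hx₀.le.trans (hYge t ht)
    have hYg : ∀ t ∈ Icc 0 T, 0 ≤ Y t + g t := fun t ht =>
      add_nonneg (hY0 t ht) (hg_nonneg t ht.1)
    have hY' : ContinuousOn (fun s => a s * b (Y s + g s)) (Icc 0 T) :=
      (ha_cont.mono hsub).mul (hb_cont.comp (hY.add (hg_cont.mono hsub)) hYg)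
    have hinv : ContinuousOn (fun y => 1 / b y) (Ici 0) :=
      continuousOn_const.div hb_cont fun y hy => (hb_pos y hy).ne'
    have hderiv : ∀ t ∈ Ioo 0 T, HasDerivAt Y (a t * b (Y t + g t)) t := by
      intro t ht
      have hnhds : Icc 0 T ∈ 𝓝 t := Icc_mem_nhds ht.1 ht.2
      have h := intervalIntegral.integral_hasDerivAt_right
        ((hY'.mono (Icc_subset_Icc_right ht.2.le)).intervalIntegrable_of_Icc ht.1.le)
        ((hY'.mono Ioo_subset_Icc_self).stronglyMeasurableAtFilter isOpen_Ioo t ht)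
        (hY'.continuousAt hnhds)
      exact (h.const_add x₀).congr_of_eventuallyEq (eventually_of_mem hnhds hYeq)
    have hinvY : ContinuousOn (fun s => 1 / b (Y s)) (Icc 0 T) := hinv.comp hY hY0
    have hsubst := intervalIntegral.integral_comp_mul_deriv'' (a := 0) (b := T) (f := Y)
      (f' := fun s => a s * b (Y s + g s)) (g := fun y => 1 / b y)
      (by rwa [uIcc_of_le hT.le])
      (fun t ht => (hderiv t (by simpa [hT.le] using ht)).hasDerivWithinAt)
      (by rwa [uIcc_of_le hT.le])
      (by
        rw [uIcc_of_le hT.le]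
        exact hinv.mono (image_subset_iff.2 hY0))
    have hYzero : Y 0 = x₀ := by simpa using hYeq 0 ⟨le_rfl, hT.le⟩
    have hYT : x₀ ≤ Y T := hYge T ⟨hT.le, le_rfl⟩
    have hle : ∫ s in (0 : ℝ)..T, a s ≤ ∫ y in x₀..Y T, 1 / b y := by
      rw [← hYzero, ← hsubst]
      refine intervalIntegral.integral_mono_on hT.le
        ((ha_cont.mono hsub).intervalIntegrable_of_Icc hT.le)
        ((hinvY.mul hY').intervalIntegrable_of_Icc hT.le) fun s hs => ?_
      have hb := hb_mono (hY0 s hs) (hYg s hs) (le_add_of_nonneg_right (hg_nonneg s hs.1))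
      have hbpos := hb_pos _ (hY0 s hs)
      simp only [Function.comp_apply]
      rw [one_div_mul_eq_div, le_div_iff₀ hbpos]
      exact mul_le_mul_of_nonneg_left hb (ha_pos s hs.1).le
    have hsubIcc : Icc x₀ (Y T) ⊆ Ici 0 := fun y hy => hx₀.le.trans hy.1
    calc ENNReal.ofReal (∫ s in (0 : ℝ)..T, a s)
        ≤ ENNReal.ofReal (∫ y in x₀..Y T, 1 / b y) := ENNReal.ofReal_le_ofReal hle
      _ = ∫⁻ y in Ioc x₀ (Y T), ENNReal.ofReal (1 / b y) :=
        ofReal_intervalIntegral_eq_setLIntegral hYT (hinv.mono hsubIcc)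
          fun y hy => (one_div_pos.2 (hb_pos y (hsubIcc hy))).le
      _ ≤ ∫⁻ y in Ioi x₀, ENNReal.ofReal (1 / b y) := lintegral_mono_set Ioc_subset_Ioi_self
  refine ⟨bound, ?_⟩
  rintro ⟨Y, hY, hYeq⟩
  refine hBA.not_ge (setLIntegral_Ioi_le_of_forall_Ioc fun T hT => ?_)
  rw [← ofReal_intervalIntegral_eq_setLIntegral hT.le (ha_cont.mono Icc_subset_Ici_self)
    fun s hs => (ha_pos s hs.1).le]
  exact bound T hT Y (hY.mono Icc_subset_Ici_self) fun t ht => hYeq t ht.1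
end

section
/- Assume b is non-decreasing. Let Y : [0, T_e) → [x₀, ∞) be a continuously differentiable, strictly increasing solution of Y'(t) = a(t)·b(Y(t) + g(t)), Y(0) = x₀, with T_e < ∞ and Y(t) → ∞ as t → T_e⁻, and let Y⁻¹ : [x₀, ∞) → [0, T_e) denote its inverse. Then the explosion time satisfies A(T_e) = ∫_{x₀}^∞ ds / b(s + g(Y⁻¹(s))); that is, T_e = A⁻¹(B̄(∞)) where B̄(y) = ∫_{x₀}^y ds/b(s + g(Y⁻¹(s))). -/
open MeasureTheory Set Filter Topology
open scoped ENNReal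

/-- If `b` is non-decreasing and `Y : [0, T_e) → [x₀, ∞)` is a continuously
differentiable, strictly increasing solution of `Y' = a t * b (Y t + g t)`,
`Y 0 = x₀`, blowing up at the finite time `T_e`, with inverse `Y⁻¹ : [x₀, ∞) → [0, T_e)`,
then `A T_e = ∫_{x₀}^∞ ds / b (s + g (Y⁻¹ s))`, i.e. `T_e = A⁻¹(B̄ ∞)`. -/
theorem noisy_explosion_time_formula
    (x₀ : ℝ) (hx₀ : 0 < x₀) (a b g : ℝ → ℝ)
    (ha_cont : ContinuousOn a (Ici 0)) (ha_pos : ∀ t ∈ Ici (0 : ℝ), 0 < a t)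
    (hb_cont : ContinuousOn b (Ici 0)) (hb_pos : ∀ t ∈ Ici (0 : ℝ), 0 < b t)
    (hb_mono : MonotoneOn b (Ici 0))
    (hg_cont : ContinuousOn g (Ici 0)) (hg_nonneg : ∀ t ∈ Ici (0 : ℝ), 0 ≤ g t)
    (T_e : ℝ) (hT_e : 0 < T_e) (Y Yinv : ℝ → ℝ)
    (hY_ge : ∀ t ∈ Ico 0 T_e, x₀ ≤ Y t)
    (hY0 : Y 0 = x₀)
    (hY_mono : StrictMonoOn Y (Ico 0 T_e))
    (hY_deriv : ∀ t ∈ Ico 0 T_e, HasDerivAt Y (a t * b (Y t + g t)) t)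
    (hY_blowup : Tendsto Y (𝓝[<] T_e) atTop)
    (hYinv_left : ∀ t ∈ Ico 0 T_e, Yinv (Y t) = t)
    (hYinv_right : ∀ s ∈ Ici x₀, Yinv s ∈ Ico 0 T_e ∧ Y (Yinv s) = s) :
    ENNReal.ofReal (∫ s in (0 : ℝ)..T_e, a s)
      = ∫⁻ s in Ioi x₀, ENNReal.ofReal (1 / b (s + g (Yinv s))) := by
  have himage : Y '' Ico 0 T_e = Ici x₀ := by
    ext s
    constructor
    · rintro ⟨t, ht, rfl⟩
      exact hY_ge t ht
    · intro hs
      exact ⟨Yinv s, (hYinv_right s hs).1, (hYinv_right s hs).2⟩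
  have hintegrand : ∀ t ∈ Ico 0 T_e,
      ENNReal.ofReal |a t * b (Y t + g t)| * ENNReal.ofReal (1 / b (Y t + g (Yinv (Y t))))
        = ENNReal.ofReal (a t) := by
    intro t ht
    have hb : 0 < b (Y t + g t) :=
      hb_pos _ (add_nonneg (hx₀.le.trans (hY_ge t ht)) (hg_nonneg t ht.1))
    have hab : 0 < a t * b (Y t + g t) := mul_pos (ha_pos t ht.1) hb
    rw [hYinv_left t ht, abs_of_pos hab, ← ENNReal.ofReal_mul hab.le]
    congr 1
    field_simp
  have hint : IntegrableOn a (Ico 0 T_e) :=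
    ((ha_cont.mono Icc_subset_Ici_self).integrableOn_Icc).mono_set Ico_subset_Icc_self
  rw [← setLIntegral_congr Ioi_ae_eq_Ici.symm, ← himage,
    lintegral_image_eq_lintegral_abs_deriv_mul measurableSet_Ico
      (fun t ht => (hY_deriv t ht).hasDerivWithinAt) hY_mono.injOn,
    setLIntegral_congr_fun measurableSet_Ico hintegrand,
    intervalIntegral.integral_of_le hT_e.le, ← integral_Ico_eq_integral_Ioc,
    ofReal_integral_eq_lintegral_ofReal hint
      (ae_restrict_of_forall_mem measurableSet_Ico fun t ht => (ha_pos t ht.1).le)]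
end

section
/- Take x₀ = 1, a(t) = e^{-t}, b(u) = u³/4, and g(t) = e^t. Then: (i) every continuous function Y : [0, T) → ℝ with 0 < T ≤ 4 satisfying Y(t) = 1 + (1/4)∫_0^t e^{-s}(Y(s) + e^s)³ ds for all t ∈ [0, T) obeys Y(t) ≥ 1 + (1/4)∫_0^t Y(s)² ds and hence Y(t) ≥ (1 − t/4)⁻¹ for all t ∈ [0, T), so no such solution exists on all of [0, 4]; yet (ii) B(∞) = ∫_1^∞ 4 ds/s³ = 2 > 1 = ∫_0^∞ e^{-s} ds = A(∞). Thus finite-time explosion of the integral equation with noise does not imply B(∞) < A(∞). -/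
open MeasureTheory Set Filter Topology
open scoped ENNReal

/-- The integrand `e^{-s} (y + e^s)³` dominates `y²` strictly when `y > 0`. -/
lemma sq_lt_exp_neg_mul_add_exp_pow_three {y : ℝ} (hy : 0 < y) (s : ℝ) :
    y ^ 2 < Real.exp (-s) * (y + Real.exp s) ^ 3 := by
  have he := Real.exp_pos s
  rw [Real.exp_neg, inv_mul_eq_div, lt_div_iff₀ he]
  nlinarith [pow_pos hy 3, pow_pos he 3, mul_pos (pow_pos hy 2) he, mul_pos hy (pow_pos he 2)]

/-- The function `u ↦ (1 - u/4)⁻¹` has derivative a quarter of its square for `u < 4`. -/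
lemma hasDerivAt_inv_one_sub_div_four {u : ℝ} (hu : u < 4) :
    HasDerivAt (fun u : ℝ => (1 - u / 4)⁻¹) ((1 / 4) * ((1 - u / 4)⁻¹) ^ 2) u := by
  have hne : 1 - u / 4 ≠ 0 := by linarith
  exact ((((hasDerivAt_id' u).div_const 4).const_sub 1).fun_inv hne).congr_deriv (by field_simp)

/-- A continuous solution on `[0, t]`, `t < 4`, dominates `(1 - u/4)⁻¹`. -/
lemma inv_one_sub_div_four_le_of_integral_eq {t : ℝ} (ht0 : 0 ≤ t) (ht4 : t < 4) {Y : ℝ → ℝ}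
    (hY : ContinuousOn Y (Icc 0 t))
    (heq : ∀ u ∈ Icc (0 : ℝ) t,
      Y u = 1 + (1 / 4) * ∫ s in (0 : ℝ)..u, Real.exp (-s) * (Y s + Real.exp s) ^ 3)
    {u : ℝ} (hu : u ∈ Icc (0 : ℝ) t) : (1 - u / 4)⁻¹ ≤ Y u := by
  set Z : ℝ → ℝ := IccExtend ht0 ((Icc 0 t).domRestrict Y)
  have hZY : ∀ s ∈ Icc (0 : ℝ) t, Z s = Y s := fun s hs => IccExtend_of_mem ht0 _ hs
  have hZ : Continuous Z := hY.domRestrict.Icc_extend'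
  have hG : Continuous fun s => Real.exp (-s) * (Z s + Real.exp s) ^ 3 := by fun_prop
  set B : ℝ → ℝ := fun v => 1 + (1 / 4) * ∫ s in (0 : ℝ)..v, Real.exp (-s) * (Z s + Real.exp s) ^ 3
  have hB : ∀ v, HasDerivAt B ((1 / 4) * (Real.exp (-v) * (Z v + Real.exp v) ^ 3)) v := fun v =>
    ((hG.integral_hasStrictDerivAt 0 v).hasDerivAt.const_mul _).const_add _
  have hBY : ∀ v ∈ Icc (0 : ℝ) t, B v = Y v := by
    intro v hv
    rw [heq v hv]
    simp only [B]
    congr 2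
    refine intervalIntegral.integral_congr fun s hs => ?_
    rw [uIcc_of_le hv.1] at hs
    simp only [hZY s ⟨hs.1, hs.2.trans hv.2⟩]
  rw [← hBY u hu]
  refine image_le_of_deriv_right_lt_deriv_boundary'
    (f := fun u : ℝ => (1 - u / 4)⁻¹) (f' := fun u => (1 / 4) * ((1 - u / 4)⁻¹) ^ 2)
    (fun v hv => (hasDerivAt_inv_one_sub_div_four
      (hv.2.trans_lt ht4)).continuousAt.continuousWithinAt)
    (fun v hv => (hasDerivAt_inv_one_sub_div_four (hv.2.trans ht4)).hasDerivWithinAt)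
    (by simp [B]) (fun v _ => (hB v).continuousAt.continuousWithinAt)
    (fun v _ => (hB v).hasDerivWithinAt) (fun v hv h => ?_) hu
  have hv' : v ∈ Icc (0 : ℝ) t := ⟨hv.1, hv.2.le⟩
  have hpos : 0 < (1 - v / 4)⁻¹ := inv_pos.2 (by linarith [hv.2])
  have hZv : Z v = (1 - v / 4)⁻¹ := by rw [hZY v hv', ← hBY v hv', ← h]
  rw [hZv]
  linarith [sq_lt_exp_neg_mul_add_exp_pow_three hpos v]

/-- A continuous solution on `[0, t]`, `t < 4`, dominates `1 + (1/4)∫_0^t Y²`. -/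
lemma one_add_integral_sq_le_of_integral_eq {t : ℝ} (ht0 : 0 ≤ t) (ht4 : t < 4) {Y : ℝ → ℝ}
    (hY : ContinuousOn Y (Icc 0 t))
    (heq : ∀ u ∈ Icc (0 : ℝ) t,
      Y u = 1 + (1 / 4) * ∫ s in (0 : ℝ)..u, Real.exp (-s) * (Y s + Real.exp s) ^ 3) :
    1 + (1 / 4) * (∫ s in (0 : ℝ)..t, (Y s) ^ 2) ≤ Y t := by
  rw [heq t ⟨ht0, le_rfl⟩]
  have hY' : ContinuousOn Y (uIcc 0 t) := by rwa [uIcc_of_le ht0]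
  have hint : ∫ s in (0 : ℝ)..t, (Y s) ^ 2 ≤
      ∫ s in (0 : ℝ)..t, Real.exp (-s) * (Y s + Real.exp s) ^ 3 := by
    refine intervalIntegral.integral_mono_on ht0 (hY'.pow 2).intervalIntegrable
      (ContinuousOn.intervalIntegrable (by fun_prop)) fun s hs => ?_
    have hpos : 0 < (1 - s / 4)⁻¹ := inv_pos.2 (by linarith [hs.2])
    exact (sq_lt_exp_neg_mul_add_exp_pow_three
      (hpos.trans_le (inv_one_sub_div_four_le_of_integral_eq ht0 ht4 hY heq hs)) s).le
  linarith

/-- The function `(1 - t/4)⁻¹` is not dominated on `[0, 4)` by a continuous function on `[0, 4]`. -/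
lemma not_forall_inv_one_sub_div_four_le {Y : ℝ → ℝ} (hY : ContinuousOn Y (Icc 0 4)) :
    ¬ ∀ t ∈ Ico (0 : ℝ) 4, (1 - t / 4)⁻¹ ≤ Y t := by
  intro h
  obtain ⟨M, hM⟩ := isCompact_Icc.bddAbove_image hY
  have hle : ∀ t ∈ Icc (0 : ℝ) 4, Y t ≤ M := fun t ht => hM (mem_image_of_mem Y ht)
  have hM1 : 1 ≤ M := by
    simpa using (h 0 (by simp)).trans (hle 0 (by simp))
  have hpos : 0 < (M + 1)⁻¹ := by positivity
  have hle1 : (M + 1)⁻¹ ≤ 1 := inv_le_one_of_one_le₀ (by linarith)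
  have ht : 4 * (1 - (M + 1)⁻¹) ∈ Ico (0 : ℝ) 4 := ⟨by linarith, by linarith⟩
  have := (h _ ht).trans (hle _ (Ico_subset_Icc_self ht))
  rw [show 1 - 4 * (1 - (M + 1)⁻¹) / 4 = (M + 1)⁻¹ by ring, inv_inv] at this
  linarith

lemma lintegral_Ioi_one_one_div_pow_three_div_four :
    (∫⁻ s in Ioi (1 : ℝ), ENNReal.ofReal (1 / (s ^ 3 / 4))) = 2 := by
  have hcongr : EqOn (fun s : ℝ => 4 * s ^ (-3 : ℝ)) (fun s => 1 / (s ^ 3 / 4)) (Ioi 1) := by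
    intro s hs
    have hs0 : (0 : ℝ) < s := zero_lt_one.trans hs
    have hpow : s ^ (-3 : ℝ) = (s ^ 3)⁻¹ := by
      rw [Real.rpow_neg hs0.le]
      norm_cast
    simp only [hpow]
    field_simp
  have hint : IntegrableOn (fun s : ℝ => 1 / (s ^ 3 / 4)) (Ioi 1) :=
    IntegrableOn.congr_fun
      ((integrableOn_Ioi_rpow_of_lt (by norm_num : (-3 : ℝ) < -1) one_pos).const_mul 4)
      hcongr measurableSet_Ioi
  rw [← ofReal_integral_eq_lintegral_ofReal hint, ← setIntegral_congr_fun measurableSet_Ioi hcongr,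
    integral_const_mul, integral_Ioi_rpow_of_lt (by norm_num) one_pos]
  · norm_num
  · filter_upwards [ae_restrict_mem measurableSet_Ioi] with s hs
    have hs0 : (0 : ℝ) < s := zero_lt_one.trans hs
    simp only [Pi.zero_apply]
    positivity

lemma lintegral_Ioi_zero_exp_neg :
    (∫⁻ s in Ioi (0 : ℝ), ENNReal.ofReal (Real.exp (-s))) = 1 := by
  rw [← ofReal_integral_eq_lintegral_ofReal (integrableOn_exp_neg_Ioi 0)
    (ae_of_all _ fun s => (Real.exp_pos _).le), integral_exp_neg_Ioi_zero, ENNReal.ofReal_one]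

/-- **Counter-example.** With `x₀ = 1`, `a t = e^{-t}`, `b u = u³/4`, `g t = e^t`:
(i) any continuous solution of `Y t = 1 + (1/4)∫_0^t e^{-s}(Y s + e^s)³ ds` on `[0, T)`
with `0 < T ≤ 4` satisfies `Y t ≥ 1 + (1/4)∫_0^t (Y s)² ds` and `Y t ≥ (1 - t/4)⁻¹`,
and no such solution exists on all of `[0, 4]`; yet
(ii) `B ∞ = ∫_1^∞ 4/s³ ds = 2 > 1 = ∫_0^∞ e^{-s} ds = A ∞`.
Hence finite-time explosion of the noisy equation does not imply `B ∞ < A ∞`. -/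
theorem counterexample_noisy_explosion :
    (∀ T : ℝ, 0 < T → T ≤ 4 → ∀ Y : ℝ → ℝ, ContinuousOn Y (Ico 0 T) →
      (∀ t ∈ Ico (0 : ℝ) T,
        Y t = 1 + (1 / 4) * ∫ s in (0 : ℝ)..t, Real.exp (-s) * (Y s + Real.exp s) ^ 3) →
      ∀ t ∈ Ico (0 : ℝ) T,
        1 + (1 / 4) * (∫ s in (0 : ℝ)..t, (Y s) ^ 2) ≤ Y t ∧ (1 - t / 4)⁻¹ ≤ Y t) ∧
    (¬ ∃ Y : ℝ → ℝ, ContinuousOn Y (Icc 0 4) ∧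
        ∀ t ∈ Icc (0 : ℝ) 4,
          Y t = 1 + (1 / 4) * ∫ s in (0 : ℝ)..t, Real.exp (-s) * (Y s + Real.exp s) ^ 3) ∧
    (∫⁻ s in Ioi (1 : ℝ), ENNReal.ofReal (1 / (s ^ 3 / 4))) = 2 ∧
    (∫⁻ s in Ioi (0 : ℝ), ENNReal.ofReal (Real.exp (-s))) = 1 := by
  refine ⟨fun T _ hT4 Y hY heq t ht => ?_, ?_, lintegral_Ioi_one_one_div_pow_three_div_four,
    lintegral_Ioi_zero_exp_neg⟩
  · have hsub : Icc 0 t ⊆ Ico 0 T := Icc_subset_Ico_right ht.2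
    have ht4 := ht.2.trans_le hT4
    have heq' := fun u hu => heq u (hsub hu)
    exact ⟨one_add_integral_sq_le_of_integral_eq ht.1 ht4 (hY.mono hsub) heq',
      inv_one_sub_div_four_le_of_integral_eq ht.1 ht4 (hY.mono hsub) heq' ⟨ht.1, le_rfl⟩⟩
  · rintro ⟨Y, hY, heq⟩
    refine not_forall_inv_one_sub_div_four_le hY fun t ht => ?_
    have hsub : Icc 0 t ⊆ Icc 0 4 := Icc_subset_Icc_right ht.2.le
    exact inv_one_sub_div_four_le_of_integral_eq ht.1 ht.2 (hY.mono hsub)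
      (fun u hu => heq u (hsub hu)) ⟨ht.1, le_rfl⟩
end

section
/- Assume b is non-decreasing, and assume that for every t ≥ 0, sup_{s ∈ [0,t]} g(s) < b(x₀)·∫_t^∞ a(s) ds. If Y : [0, T_e) → [x₀, ∞) is a continuously differentiable, strictly increasing solution of Y'(t) = a(t)·b(Y(t) + g(t)), Y(0) = x₀, with T_e < ∞ and Y(t) → ∞ as t → T_e⁻, then ∫_{x₀}^∞ ds/b(s) < ∫_0^∞ a(s) ds. -/
open MeasureTheory Set Filter Topology
open scoped ENNReal

/-- If `Y` solves `Y' = a (b ∘ (Y + g))` with `g ≤ G` and explodes at `T`, then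
`∫_{Y 0 + G}^∞ ds / b s ≤ ∫_0^T a s ds`. -/
theorem lintegral_inv_le_of_explosion {a b g Y : ℝ → ℝ} {T G : ℝ} (hT : 0 < T)
    (ha_pos : ∀ t ∈ Ici (0 : ℝ), 0 < a t) (hb_pos : ∀ t ∈ Ici (0 : ℝ), 0 < b t)
    (hb_mono : MonotoneOn b (Ici 0))
    (hg_nonneg : ∀ t ∈ Ici (0 : ℝ), 0 ≤ g t) (hgG : ∀ t ∈ Ico 0 T, g t ≤ G)
    (hY_nonneg : ∀ t ∈ Ico 0 T, 0 ≤ Y t) (hY_mono : StrictMonoOn Y (Ico 0 T))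
    (hY_deriv : ∀ t ∈ Ico 0 T, HasDerivAt Y (a t * b (Y t + g t)) t)
    (hY_blowup : Tendsto Y (𝓝[<] T) atTop) :
    (∫⁻ s in Ioi (Y 0 + G), ENNReal.ofReal (1 / b s))
      ≤ ∫⁻ s in Ioc 0 T, ENNReal.ofReal (a s) := by
  have h_image : Ioi (Y 0 + G) ⊆ (fun t => Y t + G) '' Ico 0 T := by
    intro y hy
    obtain ⟨t, hty, ht0, htT⟩ := ((hY_blowup.eventually_ge_atTop (y - G)).and
      (Ioo_mem_nhdsLT hT)).exists
    have h_cont : ContinuousOn (fun s => Y s + G) (Icc 0 t) := fun s hs =>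
      ((hY_deriv s ⟨hs.1, hs.2.trans_lt htT⟩).continuousAt.add
        continuousAt_const).continuousWithinAt
    obtain ⟨s, hs, rfl⟩ := intermediate_value_Icc ht0.le h_cont
      (show y ∈ Icc (Y 0 + G) (Y t + G) from ⟨(mem_Ioi.1 hy).le, by linarith⟩)
    exact ⟨s, ⟨hs.1, hs.2.trans_lt htT⟩, rfl⟩
  calc (∫⁻ s in Ioi (Y 0 + G), ENNReal.ofReal (1 / b s))
      ≤ ∫⁻ s in (fun t => Y t + G) '' Ico 0 T, ENNReal.ofReal (1 / b s) :=
        lintegral_mono_set h_image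
    _ = ∫⁻ t in Ico 0 T, ENNReal.ofReal |a t * b (Y t + g t)|
          * ENNReal.ofReal (1 / b (Y t + G)) :=
        lintegral_image_eq_lintegral_abs_deriv_mul measurableSet_Ico
          (fun t ht => ((hY_deriv t ht).add_const G).hasDerivWithinAt)
          (fun s hs t ht hst => hY_mono.injOn hs ht (add_right_cancel hst)) _
    _ ≤ ∫⁻ t in Ico 0 T, ENNReal.ofReal (a t) := by
        refine setLIntegral_mono' measurableSet_Ico fun t ht => ?_
        have hg0 := hg_nonneg t ht.1
        have h1 : Y t + g t ∈ Ici (0 : ℝ) := add_nonneg (hY_nonneg t ht) hg0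
        have h2 : Y t + G ∈ Ici (0 : ℝ) :=
          add_nonneg (hY_nonneg t ht) (hg0.trans (hgG t ht))
        have hle : b (Y t + g t) ≤ b (Y t + G) := hb_mono h1 h2 (by linarith [hgG t ht])
        have ha := ha_pos t ht.1
        rw [← ENNReal.ofReal_mul (abs_nonneg _), abs_of_pos (mul_pos ha (hb_pos _ h1)),
          mul_one_div]
        refine ENNReal.ofReal_le_ofReal ((div_le_iff₀ (hb_pos _ h2)).2 ?_)
        exact mul_le_mul_of_nonneg_left hle ha.le
    _ = ∫⁻ s in Ioc 0 T, ENNReal.ofReal (a s) := by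
        rw [setLIntegral_congr Ico_ae_eq_Ioc]

/-- **Partial converse.** Assume `b` is non-decreasing and
`ĝ t = sup_{s ∈ [0,t]} g s < b x₀ * ∫_t^∞ a s ds` for every `t ≥ 0`. If
`Y : [0, T_e) → [x₀, ∞)` is a continuously differentiable, strictly increasing
solution of `Y' = a t * b (Y t + g t)`, `Y 0 = x₀`, exploding at the finite time
`T_e`, then `∫_{x₀}^∞ ds / b s < ∫_0^∞ a s ds`. -/
theorem partial_converse
    (x₀ : ℝ) (hx₀ : 0 < x₀) (a b g : ℝ → ℝ)
    (ha_cont : ContinuousOn a (Ici 0)) (ha_pos : ∀ t ∈ Ici (0 : ℝ), 0 < a t)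
    (hb_cont : ContinuousOn b (Ici 0)) (hb_pos : ∀ t ∈ Ici (0 : ℝ), 0 < b t)
    (hb_mono : MonotoneOn b (Ici 0))
    (hg_cont : ContinuousOn g (Ici 0)) (hg_nonneg : ∀ t ∈ Ici (0 : ℝ), 0 ≤ g t)
    (hg_small : ∀ t ∈ Ici (0 : ℝ),
      ENNReal.ofReal (sSup (g '' Icc 0 t))
        < ENNReal.ofReal (b x₀) * ∫⁻ s in Ioi t, ENNReal.ofReal (a s))
    (T_e : ℝ) (hT_e : 0 < T_e) (Y : ℝ → ℝ)
    (hY_ge : ∀ t ∈ Ico 0 T_e, x₀ ≤ Y t)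
    (hY0 : Y 0 = x₀)
    (hY_mono : StrictMonoOn Y (Ico 0 T_e))
    (hY_deriv : ∀ t ∈ Ico 0 T_e, HasDerivAt Y (a t * b (Y t + g t)) t)
    (hY_blowup : Tendsto Y (𝓝[<] T_e) atTop) :
    (∫⁻ s in Ioi x₀, ENNReal.ofReal (1 / b s))
      < ∫⁻ s in Ioi (0 : ℝ), ENNReal.ofReal (a s) := by
  set G := sSup (g '' Icc 0 T_e)
  have hgG : ∀ t ∈ Icc 0 T_e, g t ≤ G := fun t ht =>
    le_csSup (isCompact_Icc.image_of_continuousOn (hg_cont.mono Icc_subset_Ici_self)).bddAbove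
      (mem_image_of_mem g ht)
  have hG0 : 0 ≤ G := (hg_nonneg 0 self_mem_Ici).trans (hgG 0 ⟨le_rfl, hT_e.le⟩)
  have hbx : 0 < b x₀ := hb_pos x₀ hx₀.le
  have h_head : (∫⁻ s in Ioc x₀ (x₀ + G), ENNReal.ofReal (1 / b s))
      < ∫⁻ s in Ioi T_e, ENNReal.ofReal (a s) := by
    calc (∫⁻ s in Ioc x₀ (x₀ + G), ENNReal.ofReal (1 / b s))
        ≤ ∫⁻ _ in Ioc x₀ (x₀ + G), ENNReal.ofReal (1 / b x₀) :=
          setLIntegral_mono' measurableSet_Ioc fun s hs => ENNReal.ofReal_le_ofReal <|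
            one_div_le_one_div_of_le hbx (hb_mono hx₀.le (hx₀.le.trans hs.1.le) hs.1.le)
      _ = ENNReal.ofReal G / ENNReal.ofReal (b x₀) := by
          rw [setLIntegral_const, Real.volume_Ioc, add_sub_cancel_left, one_div,
            ENNReal.ofReal_inv_of_pos hbx, mul_comm, div_eq_mul_inv]
      _ < ∫⁻ s in Ioi T_e, ENNReal.ofReal (a s) :=
          ENNReal.div_lt_of_lt_mul' (hg_small T_e hT_e.le)
  have h_tail : (∫⁻ s in Ioi (x₀ + G), ENNReal.ofReal (1 / b s))
      ≤ ∫⁻ s in Ioc 0 T_e, ENNReal.ofReal (a s) := by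
    simpa only [hY0] using lintegral_inv_le_of_explosion hT_e ha_pos hb_pos hb_mono hg_nonneg
      (fun t ht => hgG t (Ico_subset_Icc_self ht)) (fun t ht => hx₀.le.trans (hY_ge t ht))
      hY_mono hY_deriv hY_blowup
  have h_fin : (∫⁻ s in Ioc 0 T_e, ENNReal.ofReal (a s)) ≠ ∞ :=
    (((ha_cont.mono Icc_subset_Ici_self).integrableOn_Icc).mono_set
      Ioc_subset_Icc_self).lintegral_lt_top.ne
  rw [← Ioc_union_Ioi_eq_Ioi (le_add_of_nonneg_right hG0 : x₀ ≤ x₀ + G),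
    ← Ioc_union_Ioi_eq_Ioi hT_e.le,
    lintegral_union measurableSet_Ioi (Ioc_disjoint_Ioi le_rfl),
    lintegral_union measurableSet_Ioi (Ioc_disjoint_Ioi le_rfl),
    add_comm (∫⁻ s in Ioc 0 T_e, ENNReal.ofReal (a s))]
  exact ENNReal.add_lt_add_of_lt_of_le (ne_top_of_le_ne_top h_fin h_tail) h_head h_tail
end

section
/- Assume b is non-decreasing and B(∞) < A(∞), and let T = A⁻¹(B(∞)), i.e. the unique T > 0 with A(T) = B(∞). If Y : [0, T_e) → [x₀, ∞) is a continuous solution of Y(t) = x₀ + ∫_0^t a(s)·b(Y(s) + g(s)) ds with T_e < ∞ and Y(t) → ∞ as t → T_e⁻, then, with G = sup{g(s) : s ∈ [0, T]}, the explosion time satisfies ∫_{x₀+G}^∞ ds/b(s) ≤ A(T_e) ≤ B(∞); equivalently A⁻¹(β(ĝ(T))) ≤ T_e ≤ T, where β(r) = ∫_{x₀+r}^∞ ds/b(s). -/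
open MeasureTheory Set Filter Topology
open scoped ENNReal

/-- The fundamental theorem of calculus at interior points of an order-connected set of
continuity. -/
lemma hasDerivAt_integral_of_ordConnected {f : ℝ → ℝ} {s : Set ℝ} (hs : s.OrdConnected)
    (hf : ContinuousOn f s) {p t : ℝ} (hp : p ∈ s) (ht : s ∈ 𝓝 t) :
    HasDerivAt (fun u => ∫ x in p..u, f x) (f t) t :=
  intervalIntegral.integral_hasDerivAt_right
    ((hf.mono (hs.uIcc_subset hp (mem_of_mem_nhds ht))).intervalIntegrable)
    ((hf.mono interior_subset).stronglyMeasurableAtFilter isOpen_interior t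
      (mem_interior_iff_mem_nhds.2 ht))
    (hf.continuousAt ht)

lemma ofReal_intervalIntegral_eq_lintegral {f : ℝ → ℝ} {c y : ℝ} (hcy : c ≤ y)
    (hf : ContinuousOn f (Icc c y)) (hf0 : ∀ x ∈ Icc c y, 0 ≤ f x) :
    ENNReal.ofReal (∫ x in c..y, f x) = ∫⁻ x in Ioc c y, ENNReal.ofReal (f x) := by
  rw [intervalIntegral.integral_of_le hcy]
  exact ofReal_integral_eq_lintegral_ofReal
    (hf.integrableOn_Icc.mono_set Ioc_subset_Icc_self)
    (ae_restrict_of_forall_mem measurableSet_Ioc fun x hx => hf0 x (Ioc_subset_Icc_self hx))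

/-- If the improper integral of `f` is exhausted along `u → ∞`, an eventual bound on the
partial integrals bounds the whole integral. -/
lemma lintegral_Ioi_le_of_eventually_le {ι : Type*} {l : Filter ι} [l.NeBot]
    [l.IsCountablyGenerated] {f : ℝ → ℝ≥0∞} {c : ℝ} {u : ι → ℝ} {K : ℝ≥0∞}
    (hf : AEMeasurable f (volume.restrict (Ioi c))) (hu : Tendsto u l atTop)
    (h : ∀ᶠ i in l, ∫⁻ x in Ioc c (u i), f x ≤ K) : ∫⁻ x in Ioi c, f x ≤ K := by
  refine le_of_tendsto ((aecover_Iic hu).lintegral_tendsto_of_countably_generated hf) ?_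
  filter_upwards [h] with i hi
  rwa [Measure.restrict_restrict measurableSet_Iic, Iic_inter_Ioi]

/-- Comparison of two functions that agree at the left endpoint, from their derivatives. -/
lemma le_of_hasDerivAt_le {f h f' h' : ℝ → ℝ} {p q : ℝ} (hpq : p ≤ q)
    (hf : ContinuousOn f (Icc p q)) (hh : ContinuousOn h (Icc p q))
    (hf' : ∀ t ∈ Ioo p q, HasDerivAt f (f' t) t) (hh' : ∀ t ∈ Ioo p q, HasDerivAt h (h' t) t)
    (hle : ∀ t ∈ Ioo p q, f' t ≤ h' t) (hp : f p = h p) : f q ≤ h q := by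
  have hmono : MonotoneOn (fun t => h t - f t) (Icc p q) := by
    refine monotoneOn_of_hasDerivWithinAt_nonneg (f' := fun t => h' t - f' t)
      (convex_Icc p q) (hh.sub hf) ?_ ?_ <;> rw [interior_Icc] <;> intro t ht
    · exact ((hh' t ht).sub (hf' t ht)).hasDerivWithinAt
    · exact sub_nonneg.2 (hle t ht)
  have := hmono (left_mem_Icc.2 hpq) (right_mem_Icc.2 hpq) hpq
  simp only at this
  linarith

/-- **Bounds for the explosion time.** Assume `b` is non-decreasing, `B ∞ < A ∞`,
and `T > 0` satisfies `A T = B ∞` (i.e. `T = A⁻¹(B ∞)`). If `Y` is a continuous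
solution of `Y t = x₀ + ∫_0^t a s * b (Y s + g s) ds` on `[0, T_e)` exploding at the
finite time `T_e`, then with `G = sup_{s ∈ [0,T]} g s`,
`β(G) = ∫_{x₀+G}^∞ ds / b s ≤ A T_e ≤ B ∞`; equivalently
`A⁻¹(β(ĝ T)) ≤ T_e ≤ T`. -/
theorem explosion_time_bounds
    (x₀ : ℝ) (hx₀ : 0 < x₀) (a b g : ℝ → ℝ)
    (ha_cont : ContinuousOn a (Ici 0)) (ha_pos : ∀ t ∈ Ici (0 : ℝ), 0 < a t)
    (hb_cont : ContinuousOn b (Ici 0)) (hb_pos : ∀ t ∈ Ici (0 : ℝ), 0 < b t)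
    (hb_mono : MonotoneOn b (Ici 0))
    (hg_cont : ContinuousOn g (Ici 0)) (hg_nonneg : ∀ t ∈ Ici (0 : ℝ), 0 ≤ g t)
    (hBA : (∫⁻ s in Ioi x₀, ENNReal.ofReal (1 / b s))
        < ∫⁻ s in Ioi (0 : ℝ), ENNReal.ofReal (a s))
    (T : ℝ) (hT : 0 < T)
    (hTA : ENNReal.ofReal (∫ s in (0 : ℝ)..T, a s)
        = ∫⁻ s in Ioi x₀, ENNReal.ofReal (1 / b s))
    (T_e : ℝ) (hT_e : 0 < T_e) (Y : ℝ → ℝ)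
    (hY_cont : ContinuousOn Y (Ico 0 T_e))
    (hY_ge : ∀ t ∈ Ico 0 T_e, x₀ ≤ Y t)
    (hY_eq : ∀ t ∈ Ico 0 T_e,
      Y t = x₀ + ∫ s in (0 : ℝ)..t, a s * b (Y s + g s))
    (hY_blowup : Tendsto Y (𝓝[<] T_e) atTop) :
    (∫⁻ s in Ioi (x₀ + sSup (g '' Icc 0 T)), ENNReal.ofReal (1 / b s))
        ≤ ENNReal.ofReal (∫ s in (0 : ℝ)..T_e, a s) ∧
    ENNReal.ofReal (∫ s in (0 : ℝ)..T_e, a s)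
        ≤ ∫⁻ s in Ioi x₀, ENNReal.ofReal (1 / b s) := by
  have hinv_cont : ContinuousOn (fun s => 1 / b s) (Ici 0) :=
    continuousOn_const.div hb_cont fun s hs => (hb_pos s hs).ne'
  have hinv_nonneg : ∀ s ∈ Ici (0 : ℝ), 0 ≤ 1 / b s := fun s hs =>
    one_div_nonneg.2 (hb_pos s hs).le
  have hA_cont : ∀ t, 0 ≤ t → ContinuousOn (fun u => ∫ s in (0 : ℝ)..u, a s) (Icc 0 t) := by
    intro t ht
    simpa only [uIcc_of_le ht] using intervalIntegral.continuousOn_primitive_interval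
      (μ := volume) (f := a) (a := 0) (b := t)
      (by rw [uIcc_of_le ht]; exact (ha_cont.mono Icc_subset_Ici_self).integrableOn_Icc)
  have hA_deriv : ∀ t, 0 < t → HasDerivAt (fun u => ∫ s in (0 : ℝ)..u, a s) (a t) t :=
    fun t ht => hasDerivAt_integral_of_ordConnected ordConnected_Ici ha_cont self_mem_Ici
      (Ici_mem_nhds ht)
  have hA_mono : ∀ s t, 0 ≤ s → s < t → ∫ x in (0 : ℝ)..s, a x < ∫ x in (0 : ℝ)..t, a x := by
    intro s t hs hst
    refine (strictMonoOn_of_deriv_pos (convex_Icc 0 t) (hA_cont t (hs.trans hst.le)) ?_)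
      ⟨hs, hst.le⟩ ⟨hs.trans hst.le, le_rfl⟩ hst
    rw [interior_Icc]
    intro u hu
    rw [(hA_deriv u hu.1).deriv]
    exact ha_pos u hu.1.le
  have hY0 : Y 0 = x₀ := by simpa using hY_eq 0 ⟨le_rfl, hT_e⟩
  have hsum_nonneg : ∀ t ∈ Ico 0 T_e, Y t + g t ∈ Ici (0 : ℝ) := fun t ht =>
    add_nonneg (hx₀.le.trans (hY_ge t ht)) (hg_nonneg t ht.1)
  have hrhs_cont : ContinuousOn (fun s => a s * b (Y s + g s)) (Ico 0 T_e) :=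
    (ha_cont.mono Ico_subset_Ici_self).mul
      (hb_cont.comp (hY_cont.add (hg_cont.mono Ico_subset_Ici_self)) hsum_nonneg)
  have hY_deriv : ∀ t ∈ Ioo 0 T_e, HasDerivAt Y (a t * b (Y t + g t)) t := by
    intro t ht
    have hmem : Ico 0 T_e ∈ 𝓝 t := Ico_mem_nhds ht.1 ht.2
    refine ((hasDerivAt_integral_of_ordConnected ordConnected_Ico hrhs_cont
      (left_mem_Ico.2 hT_e) hmem).const_add x₀).congr_of_eventuallyEq ?_
    filter_upwards [hmem] with u hu using hY_eq u hu
  -- The separated variable, shifted by a constant `r`.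
  have hF_deriv : ∀ r, 0 ≤ r → ∀ y, x₀ ≤ y →
      HasDerivAt (fun v => ∫ s in (x₀ + r)..v, 1 / b s) (1 / b (y + r)) (y + r) :=
    fun r hr y hy => hasDerivAt_integral_of_ordConnected ordConnected_Ici hinv_cont
      (mem_Ici.2 (by linarith)) (Ici_mem_nhds (by linarith))
  have hFY_cont : ∀ r, 0 ≤ r → ∀ t ∈ Ico 0 T_e,
      ContinuousOn (fun u => ∫ s in (x₀ + r)..(Y u + r), 1 / b s) (Icc 0 t) := by
    intro r hr t ht u hu
    have hu' : u ∈ Ico 0 T_e := ⟨hu.1, hu.2.trans_lt ht.2⟩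
    exact (hF_deriv r hr (Y u) (hY_ge u hu')).continuousAt.comp_continuousWithinAt
      (f := fun u => Y u + r)
      (((hY_cont.mono (Icc_subset_Ico_right ht.2)) u hu).add continuousWithinAt_const)
  have hFY_deriv : ∀ r, 0 ≤ r → ∀ t ∈ Ioo 0 T_e,
      HasDerivAt (fun u => ∫ s in (x₀ + r)..(Y u + r), 1 / b s)
        (1 / b (Y t + r) * (a t * b (Y t + g t))) t := fun r hr t ht =>
    (hF_deriv r hr (Y t) (hY_ge t (Ioo_subset_Ico_self ht))).comp t
      (h := fun u => Y u + r) ((hY_deriv t ht).add_const r)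
  have hF_lintegral : ∀ r, 0 ≤ r → ∀ t ∈ Ico 0 T_e,
      ENNReal.ofReal (∫ s in (x₀ + r)..(Y t + r), 1 / b s)
        = ∫⁻ s in Ioc (x₀ + r) (Y t + r), ENNReal.ofReal (1 / b s) := by
    intro r hr t ht
    have hsub : Icc (x₀ + r) (Y t + r) ⊆ Ici 0 := fun s hs =>
      (add_nonneg hx₀.le hr).trans hs.1
    exact ofReal_intervalIntegral_eq_lintegral (by linarith [hY_ge t ht])
      (hinv_cont.mono hsub) fun s hs => hinv_nonneg s (hsub hs)
  have hIco : ∀ᶠ t in 𝓝[<] T_e, t ∈ Ico 0 T_e := Ico_mem_nhdsLT hT_e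
  have hupper : ENNReal.ofReal (∫ s in (0 : ℝ)..T_e, a s)
      ≤ ∫⁻ s in Ioi x₀, ENNReal.ofReal (1 / b s) := by
    refine le_of_tendsto (x := 𝓝[<] T_e) (ENNReal.continuous_ofReal.continuousAt.tendsto.comp
      ((hA_deriv T_e hT_e).continuousAt.tendsto.mono_left nhdsWithin_le_nhds)) ?_
    filter_upwards [hIco] with t ht
    have hle : ∫ s in (0 : ℝ)..t, a s ≤ ∫ s in (x₀ + 0)..(Y t + 0), 1 / b s := by
      refine le_of_hasDerivAt_le (f := fun u => ∫ s in (0 : ℝ)..u, a s)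
        (h := fun u => ∫ s in (x₀ + 0)..(Y u + 0), 1 / b s) ht.1 (hA_cont t ht.1)
        (hFY_cont 0 le_rfl t ht)
        (fun u hu => hA_deriv u hu.1)
        (fun u hu => hFY_deriv 0 le_rfl u ⟨hu.1, hu.2.trans ht.2⟩) ?_ (by simp [hY0])
      intro u hu
      have hu' : u ∈ Ico 0 T_e := ⟨hu.1.le, hu.2.trans ht.2⟩
      have hYu : Y u + 0 ∈ Ici (0 : ℝ) := by
        simpa using hx₀.le.trans (hY_ge u hu')
      rw [one_div_mul_eq_div, le_div_iff₀ (hb_pos _ hYu)]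
      exact mul_le_mul_of_nonneg_left
        (hb_mono hYu (hsum_nonneg u hu') (by linarith [hg_nonneg u hu.1.le]))
        (ha_pos u hu.1.le).le
    refine (ENNReal.ofReal_le_ofReal hle).trans ?_
    rw [hF_lintegral 0 le_rfl t ht, add_zero]
    exact lintegral_mono_set Ioc_subset_Ioi_self
  refine ⟨?_, hupper⟩
  have hT_e_le : T_e ≤ T := by
    by_contra! hlt
    rw [← hTA] at hupper
    have hpos : 0 < ∫ s in (0 : ℝ)..T, a s := by simpa using hA_mono 0 T le_rfl hT
    exact (hA_mono T T_e hT.le hlt).not_ge ((ENNReal.ofReal_le_ofReal_iff hpos.le).1 hupper)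
  set G := sSup (g '' Icc 0 T)
  have hgG : ∀ t ∈ Icc 0 T, g t ≤ G := fun t ht =>
    le_csSup (isCompact_Icc.bddAbove_image (hg_cont.mono Icc_subset_Ici_self))
      (mem_image_of_mem g ht)
  have hG0 : 0 ≤ G := (hg_nonneg 0 self_mem_Ici).trans (hgG 0 (left_mem_Icc.2 hT.le))
  have hmeas : AEMeasurable (fun s => ENNReal.ofReal (1 / b s))
      (volume.restrict (Ioi (x₀ + G))) :=
    ((hinv_cont.mono fun s hs => (add_nonneg hx₀.le hG0).trans
      (le_of_lt hs)).aemeasurable measurableSet_Ioi).ennreal_ofReal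
  refine lintegral_Ioi_le_of_eventually_le hmeas
    (tendsto_atTop_add_const_right _ G hY_blowup) ?_
  filter_upwards [hIco] with t ht
  rw [← hF_lintegral G hG0 t ht]
  refine ENNReal.ofReal_le_ofReal (le_trans ?_ (hA_mono t T_e ht.1 ht.2).le)
  refine le_of_hasDerivAt_le (f := fun u => ∫ s in (x₀ + G)..(Y u + G), 1 / b s)
    (h := fun u => ∫ s in (0 : ℝ)..u, a s) ht.1 (hFY_cont G hG0 t ht) (hA_cont t ht.1)
    (fun u hu => hFY_deriv G hG0 u ⟨hu.1, hu.2.trans ht.2⟩)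
    (fun u hu => hA_deriv u hu.1) ?_ (by simp [hY0])
  intro u hu
  have hu' : u ∈ Ico 0 T_e := ⟨hu.1.le, hu.2.trans ht.2⟩
  have hYu : Y u + G ∈ Ici (0 : ℝ) := add_nonneg (hx₀.le.trans (hY_ge u hu')) hG0
  rw [one_div_mul_eq_div, div_le_iff₀ (hb_pos _ hYu)]
  exact mul_le_mul_of_nonneg_left
    (hb_mono (hsum_nonneg u hu') hYu
      (by linarith [hgG u ⟨hu.1.le, hu'.2.le.trans hT_e_le⟩]))
    (ha_pos u hu.1.le).le
end

section
/- Assume b is non-decreasing. If Y : [0, T) → ℝ is a continuous function satisfying Y(t) = x₀ + ∫_0^t a(s)·b(Y(s) + g(s)) ds for all t ∈ [0, T), then ∫_{x₀}^{Y(t)} ds/b(s) ≥ ∫_0^t a(s) ds for every t ∈ [0, T); that is, Y(t) ≥ B⁻¹(A(t)), the solution dominates the solution of the noiseless equation with the same initial value. -/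
open MeasureTheory Set Filter Topology
open scoped ENNReal

/-- If `Y` starts at a positive value `x₀` and its increments are the integral of a function `F`
that is nonnegative wherever `Y` is positive, then `Y` never falls below `x₀`. -/
theorem le_of_eq_add_integral_of_nonneg_of_pos {x₀ t : ℝ} (hx₀ : 0 < x₀) {Y F : ℝ → ℝ}
    (hY : ContinuousOn Y (Icc 0 t)) (hF : ∀ s ∈ Icc 0 t, 0 < Y s → 0 ≤ F s)
    (h_eq : ∀ s ∈ Icc 0 t, Y s = x₀ + ∫ r in (0 : ℝ)..s, F r) :
    ∀ s ∈ Icc 0 t, x₀ ≤ Y s := by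
  have le_of_pos : ∀ τ ∈ Icc 0 t, (∀ s ∈ Ico 0 τ, 0 < Y s) → x₀ ≤ Y τ := by
    intro τ hτ hpos
    have : 0 ≤ ∫ r in (0 : ℝ)..τ, F r := by
      rw [intervalIntegral.integral_of_le hτ.1, integral_Ioc_eq_integral_Ioo]
      refine setIntegral_nonneg measurableSet_Ioo fun s hs => ?_
      exact hF s ⟨hs.1.le, hs.2.le.trans hτ.2⟩ (hpos s ⟨hs.1.le, hs.2⟩)
    linarith [h_eq τ hτ]
  have pos : ∀ s ∈ Icc 0 t, 0 < Y s := by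
    by_contra! hneg
    obtain ⟨s, hs, hYs⟩ := hneg
    have hcompact : IsCompact (Icc 0 t ∩ Y ⁻¹' Iic 0) :=
      isCompact_Icc.of_isClosed_subset (hY.preimage_isClosed_of_isClosed isClosed_Icc isClosed_Iic)
        inter_subset_left
    obtain ⟨τ, ⟨hτ, hYτ⟩, hmin⟩ := hcompact.exists_isLeast ⟨s, hs, hYs⟩
    have := le_of_pos τ hτ fun r hr => by
      by_contra! hr'
      exact (hmin ⟨⟨hr.1, hr.2.le.trans hτ.2⟩, hr'⟩).not_gt hr.2
    exact (hx₀.trans_le this).not_ge hYτ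
  exact fun s hs => le_of_pos s hs fun r hr => pos r ⟨hr.1, hr.2.le.trans hs.2⟩

/-- If `b` is non-decreasing and `Y` is a continuous solution of the noisy integral
equation `Y t = x₀ + ∫_0^t a s * b (Y s + g s) ds` on `[0, T)`, then
`∫_{x₀}^{Y t} ds / b s ≥ ∫_0^t a s ds` for every `t ∈ [0, T)`; that is,
`Y t ≥ B⁻¹(A t)`: the noisy solution dominates the noiseless one. -/
theorem noisy_dominates_noiseless
    (x₀ : ℝ) (hx₀ : 0 < x₀) (a b g : ℝ → ℝ)
    (ha_cont : ContinuousOn a (Ici 0)) (ha_pos : ∀ t ∈ Ici (0 : ℝ), 0 < a t)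
    (hb_cont : ContinuousOn b (Ici 0)) (hb_pos : ∀ t ∈ Ici (0 : ℝ), 0 < b t)
    (hb_mono : MonotoneOn b (Ici 0))
    (hg_cont : ContinuousOn g (Ici 0)) (hg_nonneg : ∀ t ∈ Ici (0 : ℝ), 0 ≤ g t)
    (T : ℝ≥0∞) (hT : 0 < T) (Y : ℝ → ℝ)
    (hY_cont : ContinuousOn Y {t : ℝ | 0 ≤ t ∧ ENNReal.ofReal t < T})
    (hY_eq : ∀ t : ℝ, 0 ≤ t → ENNReal.ofReal t < T →
      Y t = x₀ + ∫ s in (0 : ℝ)..t, a s * b (Y s + g s)) :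
    ∀ t : ℝ, 0 ≤ t → ENNReal.ofReal t < T →
      (∫ s in (0 : ℝ)..t, a s) ≤ ∫ s in x₀..(Y t), 1 / b s := by
  intro t ht htT
  have hdom : ∀ s ∈ Icc 0 t, ENNReal.ofReal s < T := fun s hs =>
    (ENNReal.ofReal_le_ofReal hs.2).trans_lt htT
  have hY : ContinuousOn Y (Icc 0 t) := hY_cont.mono fun s hs => ⟨hs.1, hdom s hs⟩
  have hYx₀ : ∀ s ∈ Icc 0 t, x₀ ≤ Y s :=
    le_of_eq_add_integral_of_nonneg_of_pos hx₀ hY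
      (fun s hs hYs => (mul_pos (ha_pos s hs.1)
        (hb_pos _ (add_nonneg hYs.le (hg_nonneg s hs.1)))).le)
      fun s hs => hY_eq s hs.1 (hdom s hs)
  have hY0 : ∀ s ∈ Icc 0 t, 0 ≤ Y s := fun s hs => hx₀.le.trans (hYx₀ s hs)
  have ha : ContinuousOn a (Icc 0 t) := ha_cont.mono Icc_subset_Ici_self
  have hF : ContinuousOn (fun s => a s * b (Y s + g s)) (Icc 0 t) :=
    ha.mul (hb_cont.comp (hY.add (hg_cont.mono Icc_subset_Ici_self))
      fun s hs => add_nonneg (hY0 s hs) (hg_nonneg s hs.1))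
  have hb_inv : ContinuousOn (fun x => 1 / b x) (Ici 0) :=
    continuousOn_const.div hb_cont fun x hx => (hb_pos x hx).ne'
  have hderiv : ∀ s ∈ Ioo 0 t, HasDerivAt Y (a s * b (Y s + g s)) s := by
    intro s hs
    have hnhds : Icc 0 t ∈ 𝓝 s := Icc_mem_nhds hs.1 hs.2
    have hint : HasDerivAt (fun u => x₀ + ∫ r in (0 : ℝ)..u, a r * b (Y r + g r))
        (a s * b (Y s + g s)) s :=
      (intervalIntegral.integral_hasDerivAt_right
        ((hF.mono (Icc_subset_Icc_right hs.2.le)).intervalIntegrable_of_Icc hs.1.le)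
        ((hF.mono Ioo_subset_Icc_self).stronglyMeasurableAtFilter isOpen_Ioo s hs)
        (hF.continuousAt hnhds)).const_add x₀
    refine hint.congr_of_eventuallyEq ?_
    filter_upwards [hnhds] with u hu using hY_eq u hu.1 (hdom u hu)
  have hchange : ∫ s in (0 : ℝ)..t, ((fun x => 1 / b x) ∘ Y) s * (a s * b (Y s + g s)) =
      ∫ x in Y 0..Y t, 1 / b x := by
    refine intervalIntegral.integral_comp_mul_deriv'' (by rwa [uIcc_of_le ht]) ?_
      (by rwa [uIcc_of_le ht]) (hb_inv.mono ?_)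
    · rw [min_eq_left ht, max_eq_right ht]
      exact fun s hs => (hderiv s hs).hasDerivWithinAt
    · rw [uIcc_of_le ht]
      rintro _ ⟨s, hs, rfl⟩
      exact hY0 s hs
  have hY_zero : Y 0 = x₀ := by
    simpa using hY_eq 0 le_rfl (by simpa using hT)
  rw [← hY_zero, ← hchange]
  refine intervalIntegral.integral_mono_on ht (ha.intervalIntegrable_of_Icc ht)
    (((hb_inv.comp hY hY0).mul hF).intervalIntegrable_of_Icc ht) fun s hs => ?_
  have hbY : 0 < b (Y s) := hb_pos _ (hY0 s hs)
  have hle : b (Y s) ≤ b (Y s + g s) :=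
    hb_mono (hY0 s hs) (add_nonneg (hY0 s hs) (hg_nonneg s hs.1))
      (le_add_of_nonneg_right (hg_nonneg s hs.1))
  rw [Function.comp_apply, one_div_mul_eq_div, le_div_iff₀ hbY]
  exact mul_le_mul_of_nonneg_left hle (ha_pos s hs.1).le
end

section
/- Assume b is non-decreasing. Let Y : [0, T) → [x₀, ∞) be a continuously differentiable solution of Y'(t) = a(t)·b(Y(t) + g(t)), Y(0) = x₀, and suppose G ≥ 0 satisfies g(s) ≤ G for all s ∈ [0, T). Then for every t ∈ [0, T): ∫_{x₀+G}^{Y(t)+G} ds/b(s) ≤ ∫_0^t a(s) ds; that is, Y is dominated by the solution of the equation with constant noise G. -/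
open MeasureTheory Set Filter Topology
open scoped ENNReal

/-- If `b` is non-decreasing, `Y : [0, T) → [x₀, ∞)` is a continuously differentiable
solution of `Y' = a t * b (Y t + g t)`, `Y 0 = x₀`, and `g s ≤ G` on `[0, T)` with
`G ≥ 0`, then for every `t ∈ [0, T)`:
`∫_{x₀+G}^{Y t + G} ds / b s ≤ ∫_0^t a s ds`; i.e. `Y` is dominated by the solution
with constant noise `G`. -/
theorem dominated_by_constant_noise
    (x₀ G : ℝ) (hx₀ : 0 < x₀) (hG : 0 ≤ G) (a b g : ℝ → ℝ)
    (ha_cont : ContinuousOn a (Ici 0)) (ha_pos : ∀ t ∈ Ici (0 : ℝ), 0 < a t)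
    (hb_cont : ContinuousOn b (Ici 0)) (hb_pos : ∀ t ∈ Ici (0 : ℝ), 0 < b t)
    (hb_mono : MonotoneOn b (Ici 0))
    (hg_cont : ContinuousOn g (Ici 0)) (hg_nonneg : ∀ t ∈ Ici (0 : ℝ), 0 ≤ g t)
    (T : ℝ≥0∞) (hT : 0 < T) (Y : ℝ → ℝ)
    (hY_ge : ∀ t : ℝ, 0 ≤ t → ENNReal.ofReal t < T → x₀ ≤ Y t)
    (hY0 : Y 0 = x₀)
    (hY_deriv : ∀ t : ℝ, 0 ≤ t → ENNReal.ofReal t < T →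
      HasDerivAt Y (a t * b (Y t + g t)) t)
    (hgG : ∀ s : ℝ, 0 ≤ s → ENNReal.ofReal s < T → g s ≤ G) :
    ∀ t : ℝ, 0 ≤ t → ENNReal.ofReal t < T →
      (∫ s in (x₀ + G)..(Y t + G), 1 / b s) ≤ ∫ s in (0 : ℝ)..t, a s := by
  intro t ht htT
  have hI : uIcc 0 t = Icc 0 t := uIcc_of_le ht
  have hlt : ∀ s ∈ Icc (0 : ℝ) t, ENNReal.ofReal s < T := fun s hs =>
    (ENNReal.ofReal_le_ofReal hs.2).trans_lt htT
  have hsub : Icc 0 t ⊆ Ici (0 : ℝ) := fun s hs => hs.1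
  have hYc : ContinuousOn Y (Icc 0 t) := fun s hs =>
    (hY_deriv s hs.1 (hlt s hs)).continuousAt.continuousWithinAt
  have hYg : ∀ s ∈ Icc (0 : ℝ) t, Y s + g s ∈ Ici (0 : ℝ) := fun s hs =>
    add_nonneg (hx₀.le.trans (hY_ge s hs.1 (hlt s hs))) (hg_nonneg s hs.1)
  have hYG : ∀ s ∈ Icc (0 : ℝ) t, Y s + G ∈ Ici (0 : ℝ) := fun s hs =>
    add_nonneg (hx₀.le.trans (hY_ge s hs.1 (hlt s hs))) hG
  have hac : ContinuousOn a (Icc 0 t) := ha_cont.mono hsub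
  have hY'c : ContinuousOn (fun s => a s * b (Y s + g s)) (Icc 0 t) :=
    hac.mul (hb_cont.comp (hYc.add (hg_cont.mono hsub)) hYg)
  have hb_inv : ContinuousOn (fun s => 1 / b s) (Ici 0) :=
    continuousOn_const.div hb_cont fun s hs => (hb_pos s hs).ne'
  have hcomp : ContinuousOn (fun s => 1 / b (Y s + G)) (Icc 0 t) :=
    hb_inv.comp (hYc.add continuousOn_const) hYG
  have hsubst : (∫ s in (0 : ℝ)..t, 1 / b (Y s + G) * (a s * b (Y s + g s))) =
      ∫ s in (x₀ + G)..(Y t + G), 1 / b s := by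
    have h := intervalIntegral.integral_comp_mul_deriv'' (a := 0) (b := t)
      (f := fun s => Y s + G) (f' := fun s => a s * b (Y s + g s)) (g := fun s => 1 / b s)
      (by rw [hI]; exact hYc.add continuousOn_const)
      (fun s hs => by
        rw [min_eq_left ht, max_eq_right ht] at hs
        exact ((hY_deriv s hs.1.le (hlt s (Ioo_subset_Icc_self hs))).add_const G).hasDerivWithinAt)
      (by rw [hI]; exact hY'c)
      (by
        rw [hI]
        exact hb_inv.mono (image_subset_iff.2 hYG))
    simpa only [Function.comp_apply, hY0] using h
  rw [← hsubst]
  refine intervalIntegral.integral_mono_on ht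
    (ContinuousOn.intervalIntegrable (by rw [hI]; exact hcomp.mul hY'c))
    (ContinuousOn.intervalIntegrable (by rwa [hI])) fun s hs => ?_
  have hle : b (Y s + g s) ≤ b (Y s + G) :=
    hb_mono (hYg s hs) (hYG s hs) (by linarith [hgG s hs.1 (hlt s hs)])
  rw [one_div_mul_eq_div, div_le_iff₀ (hb_pos _ (hYG s hs))]
  exact mul_le_mul_of_nonneg_left hle (ha_pos s hs.1).le
end

section
/- Assume b is non-decreasing and sub-multiplicative with constant c > 0 (b(xy) ≤ c·b(x)·b(y) for all x, y ≥ 0), and define Ã(t) = c·∫_0^t a(s)·b(g(s)/x₀ + 1) ds. If Y : [0, T_e) → [x₀, ∞) is a continuous solution of Y(t) = x₀ + ∫_0^t a(s)·b(Y(s) + g(s)) ds with T_e < ∞ and Y(t) → ∞ as t → T_e⁻, then Ã(T_e) ≥ ∫_{x₀}^∞ ds/b(s); that is, the explosion time satisfies T_e ≥ Ã⁻¹(B(∞)). -/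
open MeasureTheory Set Filter Topology
open scoped ENNReal

theorem ContinuousOn.intervalIntegrable_of_ordConnected {f : ℝ → ℝ} {S : Set ℝ}
    [S.OrdConnected] (hf : ContinuousOn f S) {u v : ℝ} (hu : u ∈ S) (hv : v ∈ S) :
    IntervalIntegrable f volume u v :=
  (hf.mono (Set.OrdConnected.uIcc_subset ‹_› hu hv)).intervalIntegrable

theorem ContinuousOn.hasDerivAt_integral_of_mem_nhds {f : ℝ → ℝ} {S : Set ℝ}
    [S.OrdConnected] (hf : ContinuousOn f S) {u t : ℝ} (hu : u ∈ S) (ht : S ∈ 𝓝 t) :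
    HasDerivAt (fun v => ∫ s in u..v, f s) (f t) t := by
  have hS : MeasurableSet S := Set.OrdConnected.measurableSet ‹_›
  exact intervalIntegral.integral_hasDerivAt_right
    (hf.intervalIntegrable_of_ordConnected hu (mem_of_mem_nhds ht))
    ⟨S, ht, hf.aestronglyMeasurable hS⟩ (hf.continuousAt ht)

theorem ContinuousOn.continuousOn_integral_Icc {f : ℝ → ℝ} {u v : ℝ} (h : u ≤ v)
    (hf : ContinuousOn f (Icc u v)) :
    ContinuousOn (fun t => ∫ s in u..t, f s) (Icc u v) := by
  have := intervalIntegral.continuousOn_primitive_interval (μ := volume) (f := f)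
    (a := u) (b := v) (by rw [uIcc_of_le h]; exact hf.integrableOn_Icc)
  rwa [uIcc_of_le h] at this

/-- A monotone sub-multiplicative function satisfies `b (y + z) ≤ c * b y * b (z / x + 1)`
as soon as `y ≥ x > 0` and `z ≥ 0`. -/
theorem apply_add_le_of_submultiplicative {b : ℝ → ℝ} {c x y z : ℝ}
    (hb_mono : MonotoneOn b (Ici 0))
    (hb_submul : ∀ x y : ℝ, 0 ≤ x → 0 ≤ y → b (x * y) ≤ c * b x * b y)
    (hx : 0 < x) (hy : x ≤ y) (hz : 0 ≤ z) :
    b (y + z) ≤ c * b y * b (z / x + 1) := by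
  have hy0 : 0 ≤ y := hx.le.trans hy
  have hzx : 0 ≤ z / x := div_nonneg hz hx.le
  have h : y + z ≤ y * (z / x + 1) := by
    have : x * (z / x) ≤ y * (z / x) := mul_le_mul_of_nonneg_right hy hzx
    rw [mul_div_cancel₀ z hx.ne'] at this
    linarith
  exact (hb_mono (mem_Ici.2 (by positivity)) (mem_Ici.2 (by positivity)) h).trans
    (hb_submul _ _ hy0 (by positivity))

/-- Bihari-type bound for a solution of the noisy integral equation before its explosion. -/
theorem integral_one_div_le_of_submultiplicative
    {x₀ c : ℝ} (hx₀ : 0 < x₀) {a b g : ℝ → ℝ}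
    (ha_cont : ContinuousOn a (Ici 0)) (ha_pos : ∀ t ∈ Ici (0 : ℝ), 0 < a t)
    (hb_cont : ContinuousOn b (Ici 0)) (hb_pos : ∀ t ∈ Ici (0 : ℝ), 0 < b t)
    (hb_mono : MonotoneOn b (Ici 0))
    (hb_submul : ∀ x y : ℝ, 0 ≤ x → 0 ≤ y → b (x * y) ≤ c * b x * b y)
    (hg_cont : ContinuousOn g (Ici 0)) (hg_nonneg : ∀ t ∈ Ici (0 : ℝ), 0 ≤ g t)
    {T : ℝ} {Y : ℝ → ℝ} (hY_cont : ContinuousOn Y (Ico 0 T))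
    (hY_ge : ∀ t ∈ Ico 0 T, x₀ ≤ Y t)
    (hY_eq : ∀ t ∈ Ico 0 T, Y t = x₀ + ∫ s in (0 : ℝ)..t, a s * b (Y s + g s))
    {t : ℝ} (ht : t ∈ Ico 0 T) :
    (∫ s in x₀..Y t, 1 / b s) ≤ c * ∫ s in (0 : ℝ)..t, a s * b (g s / x₀ + 1) := by
  have hsub : Ico 0 T ⊆ Ici (0 : ℝ) := fun s hs => hs.1
  have hφ : ContinuousOn (fun s => a s * b (g s / x₀ + 1)) (Ici 0) := by
    refine ha_cont.mul (hb_cont.comp (by fun_prop) fun s hs => ?_)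
    have := hg_nonneg s hs
    exact mem_Ici.2 (by positivity)
  have hψ : ContinuousOn (fun s => a s * b (Y s + g s)) (Ico 0 T) := by
    refine (ha_cont.mono hsub).mul
      (hb_cont.comp (hY_cont.add (hg_cont.mono hsub)) fun s hs => ?_)
    exact mem_Ici.2 (add_nonneg (hx₀.le.trans (hY_ge s hs)) (hg_nonneg s hs.1))
  have hρ : ContinuousOn (fun s => 1 / b s) (Ici 0) :=
    continuousOn_const.div hb_cont fun s hs => (hb_pos s hs).ne'
  have hF : ∀ y, x₀ ≤ y → HasDerivAt (fun v => ∫ s in x₀..v, 1 / b s) (1 / b y) y :=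
    fun y hy => hρ.hasDerivAt_integral_of_mem_nhds (mem_Ici.2 hx₀.le)
      (Ici_mem_nhds (hx₀.trans_le hy))
  have hIcc : Icc 0 t ⊆ Ico 0 T := fun s hs => ⟨hs.1, hs.2.trans_lt ht.2⟩
  have h0 : (0 : ℝ) ∈ Ico 0 T := hIcc ⟨le_rfl, ht.1⟩
  have hmono : MonotoneOn (fun u => (c * ∫ s in (0 : ℝ)..u, a s * b (g s / x₀ + 1)) -
      ∫ s in x₀..Y u, 1 / b s) (Icc 0 t) := by
    have hd : ∀ u ∈ interior (Icc 0 t), HasDerivAt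
        (fun u => (c * ∫ s in (0 : ℝ)..u, a s * b (g s / x₀ + 1)) - ∫ s in x₀..Y u, 1 / b s)
        (c * (a u * b (g u / x₀ + 1)) - 1 / b (Y u) * (a u * b (Y u + g u))) u := by
      intro u hu
      rw [interior_Icc] at hu
      have huT : Ico 0 T ∈ 𝓝 u := Ico_mem_nhds hu.1 (hu.2.trans ht.2)
      have hY : HasDerivAt Y (a u * b (Y u + g u)) u := by
        refine ((hψ.hasDerivAt_integral_of_mem_nhds h0 huT).const_add x₀).congr_of_eventuallyEq ?_
        filter_upwards [huT] with v hv using hY_eq v hv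
      exact ((hφ.hasDerivAt_integral_of_mem_nhds (mem_Ici.2 le_rfl)
        (Ici_mem_nhds hu.1)).const_mul c).sub
          ((hF _ (hY_ge u (mem_of_mem_nhds huT))).comp u hY)
    refine monotoneOn_of_deriv_nonneg (convex_Icc 0 t) ?_
      (fun u hu => (hd u hu).differentiableAt.differentiableWithinAt) fun u hu => ?_
    · refine ((hφ.mono Icc_subset_Ici_self).continuousOn_integral_Icc ht.1).const_mul c |>.sub ?_
      exact ContinuousOn.comp (t := Ici x₀)
        (fun y hy => (hF y hy).continuousAt.continuousWithinAt)
        (hY_cont.mono hIcc) fun s hs => hY_ge s (hIcc hs)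
    · rw [(hd u hu).deriv]
      have huI := hIcc (interior_subset hu)
      have hYu := hY_ge u huI
      have hbY := hb_pos (Y u) (hx₀.le.trans hYu)
      have key := apply_add_le_of_submultiplicative hb_mono hb_submul hx₀ hYu (hg_nonneg u huI.1)
      have := mul_le_mul_of_nonneg_left key (ha_pos u huI.1).le
      rw [sub_nonneg, one_div_mul_eq_div, div_le_iff₀ hbY]
      linarith
  have h := hmono (left_mem_Icc.2 ht.1) (right_mem_Icc.2 ht.1) ht.1
  have hY0 : Y 0 = x₀ := by simpa using hY_eq 0 h0
  simpa [hY0] using h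

/-- If `b` is non-decreasing and sub-multiplicative with constant `c > 0`, and
`Y : [0, T_e) → [x₀, ∞)` is a continuous solution of the noisy integral equation
exploding at the finite time `T_e`, then `Ã T_e ≥ ∫_{x₀}^∞ ds / b s`, where
`Ã t = c * ∫_0^t a s * b (g s / x₀ + 1) ds`; that is, `T_e ≥ Ã⁻¹(B ∞)`. -/
theorem explosion_time_lower_bound_submultiplicative
    (x₀ c : ℝ) (hx₀ : 0 < x₀) (hc : 0 < c) (a b g : ℝ → ℝ)
    (ha_cont : ContinuousOn a (Ici 0)) (ha_pos : ∀ t ∈ Ici (0 : ℝ), 0 < a t)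
    (hb_cont : ContinuousOn b (Ici 0)) (hb_pos : ∀ t ∈ Ici (0 : ℝ), 0 < b t)
    (hb_mono : MonotoneOn b (Ici 0))
    (hb_submul : ∀ x y : ℝ, 0 ≤ x → 0 ≤ y → b (x * y) ≤ c * b x * b y)
    (hg_cont : ContinuousOn g (Ici 0)) (hg_nonneg : ∀ t ∈ Ici (0 : ℝ), 0 ≤ g t)
    (T_e : ℝ) (hT_e : 0 < T_e) (Y : ℝ → ℝ)
    (hY_cont : ContinuousOn Y (Ico 0 T_e))
    (hY_ge : ∀ t ∈ Ico 0 T_e, x₀ ≤ Y t)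
    (hY_eq : ∀ t ∈ Ico 0 T_e,
      Y t = x₀ + ∫ s in (0 : ℝ)..t, a s * b (Y s + g s))
    (hY_blowup : Tendsto Y (𝓝[<] T_e) atTop) :
    (∫⁻ s in Ioi x₀, ENNReal.ofReal (1 / b s))
      ≤ ENNReal.ofReal (c * ∫ s in (0 : ℝ)..T_e, a s * b (g s / x₀ + 1)) := by
  have hφ : ContinuousOn (fun s => a s * b (g s / x₀ + 1)) (Ici 0) := by
    refine ha_cont.mul (hb_cont.comp (by fun_prop) fun s hs => ?_)
    have := hg_nonneg s hs
    exact mem_Ici.2 (by positivity)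
  have hφ_nonneg : ∀ s ∈ Ici (0 : ℝ), 0 ≤ a s * b (g s / x₀ + 1) := fun s hs => by
    have := hg_nonneg s hs
    exact mul_nonneg (ha_pos s hs).le (hb_pos _ (mem_Ici.2 (by positivity))).le
  have hρ : ContinuousOn (fun s => 1 / b s) (Ici 0) :=
    continuousOn_const.div hb_cont fun s hs => (hb_pos s hs).ne'
  have hIoi : Ioi x₀ ⊆ Ici 0 := fun s hs => hx₀.le.trans (le_of_lt hs)
  refine le_of_tendsto ((aecover_Iic hY_blowup).lintegral_tendsto_of_countably_generated
    ((hρ.mono hIoi).aemeasurable measurableSet_Ioi).ennreal_ofReal) ?_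
  filter_upwards [Ioo_mem_nhdsLT hT_e] with t ht
  have htI : t ∈ Ico 0 T_e := ⟨ht.1.le, ht.2⟩
  have hYt := hY_ge t htI
  have hint := (hρ.intervalIntegrable_of_ordConnected (mem_Ici.2 hx₀.le)
    (mem_Ici.2 (hx₀.le.trans hYt)))
  rw [Measure.restrict_restrict measurableSet_Iic, inter_comm, Ioi_inter_Iic,
    ← ofReal_integral_eq_lintegral_ofReal
      ((intervalIntegrable_iff_integrableOn_Ioc_of_le hYt).1 hint)
      ((ae_restrict_iff' measurableSet_Ioc).2 (.of_forall fun s hs =>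
        one_div_nonneg.2 (hb_pos s (hIoi hs.1)).le)),
    ← intervalIntegral.integral_of_le hYt]
  refine ENNReal.ofReal_le_ofReal ((integral_one_div_le_of_submultiplicative hx₀ ha_cont ha_pos
    hb_cont hb_pos hb_mono hb_submul hg_cont hg_nonneg hY_cont hY_ge hY_eq htI).trans ?_)
  refine mul_le_mul_of_nonneg_left ?_ hc.le
  refine intervalIntegral.integral_mono_interval le_rfl htI.1 ht.2.le ?_
    (hφ.intervalIntegrable_of_ordConnected (mem_Ici.2 le_rfl) (mem_Ici.2 hT_e.le))
  exact (ae_restrict_iff' measurableSet_Ioc).2 (.of_forall fun s hs => hφ_nonneg s hs.1.le)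
end
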